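/- arXiv:1605.05282 — 3 statements merged into one kernel-verified Lean document; each statement's English description precedes it below -/
import Mathlib

section
/- Let f(x) = x^m + α_{m-1}x^{m-1} + ... + α_0 be a monic polynomial of degree m ≥ 2 and let ε satisfy 0 < ε < 1/m. Let L(t) = ∏_{j=1}^{∞} cos(2π·3^{-j} t) be the characteristic function of the Cantor distribution, and let X be a random variable whose (singular) distribution has characteristic function L^k(t), where k is any integer with k ≥ ln(2/(3^ε - 1))/0.027. Then E exp{i t f(X)} = O(|t|^{ε - 1/m}) as |t| → ∞. -/
open MeasureTheory Real Set Filter Asymptotics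

/-- phase -/
noncomputable def EE (p : Polynomial ℝ) (x : ℝ) : ℂ := Complex.exp (Complex.I * ((p.eval x : ℝ) : ℂ))

lemma EE_norm (p : Polynomial ℝ) (x : ℝ) : ‖EE p x‖ = 1 := by
  unfold EE
  rw [mul_comm]
  exact Complex.norm_exp_ofReal_mul_I _

lemma EE_hasDeriv (p : Polynomial ℝ) (x : ℝ) :
    HasDerivAt (EE p) (EE p x * (Complex.I * ((p.derivative.eval x : ℝ) : ℂ))) x := by
  have h := ((p.hasDerivAt x).ofReal_comp.const_mul Complex.I).cexp
  exact h

lemma EE_cont (p : Polynomial ℝ) : Continuous (EE p) :=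
  continuous_iff_continuousAt.2 fun x => (EE_hasDeriv p x).continuousAt

lemma EE_neg (p : Polynomial ℝ) (a b : ℝ) : ‖∫ x in a..b, EE (-p) x‖ = ‖∫ x in a..b, EE p x‖ := by
  have : ∀ x, EE (-p) x = (starRingEnd ℂ) (EE p x) := by
    intro x
    simp [EE, ← Complex.exp_conj]
  simp_rw [this]
  rw [intervalIntegral.intervalIntegral_eq_integral_uIoc, integral_conj,
    intervalIntegral.intervalIntegral_eq_integral_uIoc, norm_smul, norm_smul, RCLike.norm_conj]

lemma EE_int_le (p : Polynomial ℝ) (a b : ℝ) (h : a ≤ b) : ‖∫ x in a..b, EE p x‖ ≤ b - a := by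
  have := intervalIntegral.norm_integral_le_of_norm_le_const (a := a) (b := b) (f := EE p) (C := 1)
    (fun x _ => (EE_norm p x).le)
  rwa [abs_of_nonneg (by linarith), one_mul] at this

lemma vdc1 (p : Polynomial ℝ) (a b l : ℝ) (hab : a ≤ b) (hl : 0 < l)
    (h1 : ∀ x ∈ Icc a b, l ≤ |p.derivative.eval x|)
    (h2 : ∀ x ∈ Icc a b, 0 ≤ p.derivative.derivative.eval x) :
    ‖∫ x in a..b, EE p x‖ ≤ 4 / l := by
  have hne : ∀ x ∈ Icc a b, p.derivative.eval x ≠ 0 := fun x hx h0 => by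
    have := h1 x hx
    rw [h0, abs_zero] at this
    linarith
  have hu : uIcc a b = Icc a b := uIcc_of_le hab
  -- real inverse
  have hd : ∀ x ∈ uIcc a b, HasDerivAt (fun x => (p.derivative.eval x)⁻¹)
      (-(p.derivative.derivative.eval x) / (p.derivative.eval x) ^ 2) x := by
    intro x hx
    exact (p.derivative.hasDerivAt x).inv (hne x (hu ▸ hx))
  have hc : ContinuousOn (fun x => -(p.derivative.derivative.eval x) / (p.derivative.eval x) ^ 2)
      (uIcc a b) := by
    apply ContinuousOn.div
    · fun_prop
    · fun_prop
    · intro x hx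
      exact pow_ne_zero _ (hne x (hu ▸ hx))
  have hii : IntervalIntegrable (fun x => -(p.derivative.derivative.eval x) / (p.derivative.eval x) ^ 2)
      volume a b := hc.intervalIntegrable
  have hftc := intervalIntegral.integral_eq_sub_of_hasDerivAt hd hii
  have hinv : ∀ x ∈ Icc a b, |(p.derivative.eval x)⁻¹| ≤ 1 / l := by
    intro x hx
    rw [abs_inv, ← one_div]
    exact one_div_le_one_div_of_le hl (h1 x hx)
  have hd' : ∀ x ∈ uIcc a b, HasDerivAt (fun x => (((p.derivative.eval x)⁻¹ : ℝ) : ℂ))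
      (((-(p.derivative.derivative.eval x) / (p.derivative.eval x) ^ 2 : ℝ)) : ℂ) x :=
    fun x hx => (hd x hx).ofReal_comp
  have hibp := intervalIntegral.integral_mul_deriv_eq_deriv_mul hd'
    (fun x _ => EE_hasDeriv p x) (Complex.continuous_ofReal.comp_continuousOn hc).intervalIntegrable
    (by
      apply Continuous.intervalIntegrable
      have := EE_cont p
      fun_prop)
  have hL : ∫ x in a..b, (((p.derivative.eval x)⁻¹ : ℝ) : ℂ) *
      (EE p x * (Complex.I * ((p.derivative.eval x : ℝ) : ℂ))) = Complex.I * ∫ x in a..b, EE p x := by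
    rw [← intervalIntegral.integral_const_mul]
    apply intervalIntegral.integral_congr
    intro x hx
    have : ((p.derivative.eval x : ℝ) : ℂ) ≠ 0 := by
      exact_mod_cast hne x (hu ▸ hx)
    simp only []
    push_cast
    field_simp
  have h3 : ‖∫ x in a..b, (((-(p.derivative.derivative.eval x) / (p.derivative.eval x) ^ 2 : ℝ)) : ℂ) * EE p x‖
      ≤ 2 / l := by
    refine (intervalIntegral.norm_integral_le_integral_norm hab).trans ?_
    have : ∫ x in a..b, ‖(((-(p.derivative.derivative.eval x) / (p.derivative.eval x) ^ 2 : ℝ)) : ℂ) * EE p x‖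
       = - ∫ x in a..b, (-(p.derivative.derivative.eval x) / (p.derivative.eval x) ^ 2) := by
      rw [← intervalIntegral.integral_neg]
      apply intervalIntegral.integral_congr
      intro x hx
      have := h2 x (hu ▸ hx)
      simp only []
      rw [norm_mul, EE_norm, mul_one, Complex.norm_real, Real.norm_eq_abs, abs_of_nonpos]
      rw [neg_div]
      have : 0 ≤ p.derivative.derivative.eval x / (p.derivative.eval x) ^ 2 := by positivity
      linarith
    rw [this, hftc]
    have ha := abs_le.1 (hinv a (left_mem_Icc.2 hab))
    have hb := abs_le.1 (hinv b (right_mem_Icc.2 hab))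
    have : 2 / l = 1 / l + 1 / l := by ring
    linarith [ha.1, ha.2, hb.1, hb.2]
  have h4 : ‖∫ x in a..b, EE p x‖ = ‖Complex.I * ∫ x in a..b, EE p x‖ := by simp
  rw [h4, ← hL, hibp]
  refine (norm_sub_le _ _).trans ?_
  have h5 : ‖(((p.derivative.eval b)⁻¹ : ℝ) : ℂ) * EE p b - (((p.derivative.eval a)⁻¹ : ℝ) : ℂ) * EE p a‖ ≤ 1 / l + 1 / l := by
    refine (norm_sub_le _ _).trans ?_
    rw [norm_mul, norm_mul, EE_norm, EE_norm, mul_one, mul_one, Complex.norm_real, Complex.norm_real]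
    exact add_le_add (hinv b (right_mem_Icc.2 hab)) (hinv a (left_mem_Icc.2 hab))
  have : 4 / l = 1 / l + 1 / l + 2 / l := by ring
  linarith

lemma splitpt (h : Polynomial ℝ) (a b l : ℝ) (hab : a ≤ b)
    (h1 : ∀ x ∈ Icc a b, l ≤ h.derivative.eval x) :
    ∃ c ∈ Icc a b, (∀ x ∈ Icc a b, c < x → l * (x - c) ≤ h.eval x) ∧
      (∀ x ∈ Icc a b, x < c → l * (c - x) ≤ -h.eval x) := by
  have key : ∀ x ∈ Icc a b, ∀ y ∈ Icc a b, x ≤ y → l * (y - x) ≤ h.eval y - h.eval x := by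
    apply Convex.mul_sub_le_image_sub_of_le_deriv (convex_Icc a b)
    · fun_prop
    · exact h.differentiable.differentiableOn
    · intro x hx
      rw [Polynomial.deriv]
      exact h1 x (interior_subset hx)
  have hA := left_mem_Icc.2 hab
  have hB := right_mem_Icc.2 hab
  by_cases ha : 0 ≤ h.eval a
  · refine ⟨a, hA, fun x hx hlt => ?_, fun x hx hlt => absurd hx.1 (not_le.2 hlt)⟩
    linarith [key a hA x hx hlt.le]
  by_cases hb : h.eval b ≤ 0
  · refine ⟨b, hB, fun x hx hlt => absurd hx.2 (not_le.2 hlt), fun x hx hlt => ?_⟩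
    linarith [key x hx b hB hlt.le]
  push Not at ha hb
  obtain ⟨c, hc, hc0⟩ := intermediate_value_Icc hab (f := fun x => h.eval x) (by fun_prop)
    (show (0:ℝ) ∈ Icc _ _ from ⟨ha.le, hb.le⟩)
  simp only [] at hc0
  refine ⟨c, hc, fun x hx hlt => ?_, fun x hx hlt => ?_⟩
  · linarith [key c hc x hx hlt.le]
  · linarith [key x hx c hc hlt.le]

lemma vdcstep (p h : Polynomial ℝ) (a b l d B : ℝ) (hab : a ≤ b) (hl : 0 < l) (hd : 0 < d) (hB : 0 ≤ B)
    (h1 : ∀ x ∈ Icc a b, l ≤ h.derivative.eval x)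
    (Hp : ∀ a' b', a ≤ a' → a' ≤ b' → b' ≤ b → (∀ x ∈ Icc a' b', l * d ≤ h.eval x) →
      ‖∫ x in a'..b', EE p x‖ ≤ B)
    (Hn : ∀ a' b', a ≤ a' → a' ≤ b' → b' ≤ b → (∀ x ∈ Icc a' b', l * d ≤ -h.eval x) →
      ‖∫ x in a'..b', EE p x‖ ≤ B) :
    ‖∫ x in a..b, EE p x‖ ≤ 2 * B + 2 * d := by
  obtain ⟨c, hc, hc1, hc2⟩ := splitpt h a b l hab h1
  have hi : ∀ u v, IntervalIntegrable (EE p) volume u v := fun u v => (EE_cont p).intervalIntegrable u v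
  have e1 : ‖∫ x in a..(max a (c - d)), EE p x‖ ≤ B := by
    rcases le_total (c - d) a with h | h
    · rw [max_eq_left h]; simpa using hB
    · rw [max_eq_right h]
      refine Hn a (c - d) le_rfl h (by linarith [hc.2]) fun x hx => ?_
      have := hc2 x ⟨hx.1, by linarith [hx.2, hc.2]⟩ (by linarith [hx.2])
      refine le_trans ?_ this
      exact mul_le_mul_of_nonneg_left (by linarith [hx.2]) hl.le
  have e3 : ‖∫ x in (min b (c + d))..b, EE p x‖ ≤ B := by
    rcases le_total b (c + d) with h | h
    · rw [min_eq_left h]; simpa using hB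
    · rw [min_eq_right h]
      refine Hp (c + d) b (by linarith [hc.1]) h le_rfl fun x hx => ?_
      have := hc1 x ⟨by linarith [hx.1, hc.1], hx.2⟩ (by linarith [hx.1])
      refine le_trans ?_ this
      exact mul_le_mul_of_nonneg_left (by linarith [hx.1]) hl.le
  have e2 : ‖∫ x in (max a (c - d))..(min b (c + d)), EE p x‖ ≤ 2 * d := by
    have hle : max a (c - d) ≤ min b (c + d) := by
      apply (max_le hc.1 (by linarith)).trans (le_min hc.2 (by linarith))
    refine (EE_int_le p _ _ hle).trans ?_
    linarith [le_max_right a (c - d), min_le_right b (c + d)]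
  rw [← intervalIntegral.integral_add_adjacent_intervals (hi a (max a (c - d))) (hi _ b),
    ← intervalIntegral.integral_add_adjacent_intervals (hi (max a (c - d)) (min b (c + d))) (hi _ b)]
  refine (norm_add_le _ _).trans ?_
  have := norm_add_le (∫ x in (max a (c - d))..(min b (c + d)), EE p x) (∫ x in (min b (c + d))..b, EE p x)
  linarith

lemma vdc (n : ℕ) : ∃ C : ℝ, 0 < C ∧ ∀ (p : Polynomial ℝ) (a b l : ℝ), a ≤ b → 0 < l →
    (∀ x ∈ Icc a b, l ≤ (Polynomial.derivative^[n + 2] p).eval x) →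
    ‖∫ x in a..b, EE p x‖ ≤ C * l ^ (-(1 / ((n : ℝ) + 2))) := by
  induction n with
  | zero =>
    refine ⟨10, by norm_num, fun p a b l hab hl h => ?_⟩
    have hd : 0 < l ^ (-(1 / 2 : ℝ)) := rpow_pos_of_pos hl _
    have hld : l * l ^ (-(1 / 2 : ℝ)) = l ^ (1 / 2 : ℝ) := by
      nth_rewrite 1 [← rpow_one l]
      rw [← rpow_add hl]; norm_num
    have hld0 : 0 < l * l ^ (-(1 / 2 : ℝ)) := mul_pos hl hd
    have h' : ∀ x ∈ Icc a b, l ≤ p.derivative.derivative.eval x := h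
    have := vdcstep p p.derivative a b l (l ^ (-(1 / 2 : ℝ))) (4 / (l * l ^ (-(1 / 2 : ℝ)))) hab hl hd
      (by positivity) h'
      (fun a' b' h1 h2 h3 h4 => vdc1 p a' b' _ h2 hld0 (fun x hx => (h4 x hx).trans (le_abs_self _))
        (fun x hx => hl.le.trans (h' x ⟨h1.trans hx.1, hx.2.trans h3⟩)))
      (fun a' b' h1 h2 h3 h4 => vdc1 p a' b' _ h2 hld0 (fun x hx => (h4 x hx).trans (neg_le_abs _))
        (fun x hx => hl.le.trans (h' x ⟨h1.trans hx.1, hx.2.trans h3⟩)))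
    rw [hld] at this
    have e : 4 / l ^ (1 / 2 : ℝ) = 4 * l ^ (-(1 / 2 : ℝ)) := by
      rw [rpow_neg hl.le]; rfl
    rw [e] at this
    norm_num at this ⊢
    linarith
  | succ n ih =>
    obtain ⟨C, hC, ih⟩ := ih
    refine ⟨2 * C + 2, by positivity, fun p a b l hab hl h => ?_⟩
    have e0 : -(1 / (((n + 1 : ℕ) : ℝ) + 2)) = -(1 / ((n : ℝ) + 3)) := by push_cast; ring
    rw [e0]
    have hd : 0 < l ^ (-(1 / ((n : ℝ) + 3))) := rpow_pos_of_pos hl _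
    have hld : (l * l ^ (-(1 / ((n : ℝ) + 3)))) ^ (-(1 / ((n : ℝ) + 2))) = l ^ (-(1 / ((n : ℝ) + 3))) := by
      nth_rewrite 1 [← rpow_one l]
      rw [← rpow_add hl, ← rpow_mul hl.le]
      congr 1
      have : (n : ℝ) + 2 ≠ 0 := by positivity
      have : (n : ℝ) + 3 ≠ 0 := by positivity
      field_simp
      ring
    have hld0 := mul_pos hl hd
    have := vdcstep p (Polynomial.derivative^[n + 2] p) a b l _
      (C * (l * l ^ (-(1 / ((n : ℝ) + 3)))) ^ (-(1 / ((n : ℝ) + 2)))) hab hl hd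
      (by positivity) (fun x hx => by
        have := h x hx
        rwa [show n + 1 + 2 = (n + 2) + 1 by ring, Function.iterate_succ_apply'] at this)
      (fun a' b' h1 h2 h3 h4 => ih p a' b' _ h2 hld0 h4)
      (fun a' b' h1 h2 h3 h4 => by
        rw [← EE_neg]
        refine ih (-p) a' b' _ h2 hld0 fun x hx => ?_
        rw [Polynomial.iterate_derivative_neg, Polynomial.eval_neg]
        exact h4 x hx)
    rw [hld] at this
    linarith

lemma trig_pair (x y : ℝ) (h : x ^ 2 + y ^ 2 + x * y = 3 / 4) :
    |x| ≤ √3 / 2 ∨ |y| ≤ √3 / 2 := by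
  by_contra! hc
  obtain ⟨h1, h2⟩ := hc
  have h3 : (√3) ^ 2 = 3 := Real.sq_sqrt (by norm_num)
  have h0 : 0 ≤ √3 := Real.sqrt_nonneg 3
  have hxy : -(|x| * |y|) ≤ x * y := by rw [← abs_mul]; exact neg_abs_le _
  rw [← sq_abs x, ← sq_abs y] at h
  rcases le_total |x| |y| with hle | hle <;> nlinarith

lemma trig_three (k : ℕ) (x y z : ℝ) (hx : |x| ≤ 1) (hy : |y| ≤ 1) (hz : |z| ≤ 1)
    (h1 : x ^ 2 + y ^ 2 + x * y = 3 / 4) (h2 : x ^ 2 + z ^ 2 + x * z = 3 / 4)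
    (h3 : y ^ 2 + z ^ 2 + y * z = 3 / 4) :
    |x| ^ k + |y| ^ k + |z| ^ k ≤ 1 + 2 * (√3 / 2) ^ k := by
  have a1 : ∀ u : ℝ, |u| ≤ 1 → |u| ^ k ≤ 1 := fun u hu => pow_le_one₀ (abs_nonneg _) hu
  have a2 : ∀ u : ℝ, |u| ≤ √3 / 2 → |u| ^ k ≤ (√3 / 2) ^ k :=
    fun u hu => pow_le_pow_left₀ (abs_nonneg _) hu k
  have b1 := a1 x hx
  have b2 := a1 y hy
  have b3 := a1 z hz
  rcases trig_pair x y h1 with h | h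
  · have := a2 _ h
    rcases trig_pair y z h3 with h' | h' <;> linarith [a2 _ h']
  · have := a2 _ h
    rcases trig_pair x z h2 with h' | h' <;> linarith [a2 _ h']

lemma trig_sum (k : ℕ) (θ : ℝ) :
    |cos θ| ^ k + |cos (θ + 2 * π / 3)| ^ k + |cos (θ + 2 * (2 * π / 3))| ^ k ≤
      1 + 2 * (√3 / 2) ^ k := by
  have hc : cos (2 * π / 3) = -1 / 2 := by
    rw [show 2 * π / 3 = π - π / 3 by ring, cos_pi_sub, cos_pi_div_three]; ring
  have hs : sin (2 * π / 3) = √3 / 2 := by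
    rw [show 2 * π / 3 = π - π / 3 by ring, sin_pi_sub, sin_pi_div_three]
  have hc2 : cos (2 * (2 * π / 3)) = -1 / 2 := by rw [cos_two_mul, hc]; norm_num
  have hs2 : sin (2 * (2 * π / 3)) = -√3 / 2 := by rw [sin_two_mul, hc, hs]; ring
  have h3 : (√3) ^ 2 = 3 := Real.sq_sqrt (by norm_num)
  have hp := sin_sq_add_cos_sq θ
  apply trig_three k _ _ _ (abs_cos_le_one _) (abs_cos_le_one _) (abs_cos_le_one _) <;>
  rw [cos_add] <;> try rw [cos_add]
  · rw [hc, hs]; linear_combination (3 / 4) * hp + sin θ ^ 2 / 4 * h3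
  · rw [hc2, hs2]; linear_combination (3 / 4) * hp + sin θ ^ 2 / 4 * h3
  · rw [hc, hs, hc2, hs2]; linear_combination (3 / 4) * hp + sin θ ^ 2 / 4 * h3

noncomputable def cc (k n : ℕ) (s : ℝ) : ℝ := ∏ j ∈ Finset.range n, |cos (2 * π * s / 3 ^ (j + 1))| ^ k

lemma cc_cont (k n : ℕ) : Continuous (cc k n) := by
  unfold cc
  fun_prop

lemma cc_nonneg (k n : ℕ) (s : ℝ) : 0 ≤ cc k n s := by
  unfold cc
  positivity

lemma cc_periodic (k n : ℕ) : Function.Periodic (cc k n) (3 ^ n) := by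
  intro s
  unfold cc
  refine Finset.prod_congr rfl fun j hj => ?_
  have hj' : j + 1 ≤ n := Finset.mem_range.1 hj
  obtain ⟨r, rfl⟩ := Nat.exists_eq_add_of_le hj'
  have : 2 * π * (s + 3 ^ (j + 1 + r)) / 3 ^ (j + 1) = 2 * π * s / 3 ^ (j + 1) + ((3 ^ r : ℕ) : ℝ) * (2 * π) := by
    push_cast
    rw [pow_add]
    field_simp
  rw [this, cos_add_nat_mul_two_pi]

lemma cc_int (k n : ℕ) : ∫ s in (0:ℝ)..3 ^ n, cc k n s ≤ (1 + 2 * (√3 / 2) ^ k) ^ n := by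
  induction n with
  | zero => simp [cc]
  | succ n ih =>
    have hi : ∀ u v, IntervalIntegrable (cc k (n + 1)) volume u v :=
      fun u v => (cc_cont k (n + 1)).intervalIntegrable u v
    have hP : (3:ℝ) ^ n ≠ 0 := by positivity
    have hper := cc_periodic k n
    have hs : ∀ s, cc k (n + 1) s = cc k n s * |cos (2 * π * s / 3 ^ (n + 1))| ^ k := by
      intro s; unfold cc; rw [Finset.prod_range_succ]
    have e1 : ∫ s in (3:ℝ) ^ n..2 * 3 ^ n, cc k (n + 1) s = ∫ s in (0:ℝ)..3 ^ n, cc k (n + 1) (s + 3 ^ n) := by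
      rw [intervalIntegral.integral_comp_add_right (fun s => cc k (n + 1) s)]
      congr 1 <;> ring
    have e2 : ∫ s in 2 * (3:ℝ) ^ n..3 ^ (n + 1), cc k (n + 1) s = ∫ s in (0:ℝ)..3 ^ n, cc k (n + 1) (s + 2 * 3 ^ n) := by
      rw [intervalIntegral.integral_comp_add_right (fun s => cc k (n + 1) s)]
      congr 1 <;> ring
    have hcn := cc_cont k (n + 1)
    have hcn' := cc_cont k n
    rw [← intervalIntegral.integral_add_adjacent_intervals (hi 0 (2 * 3 ^ n)) (hi _ _),
      ← intervalIntegral.integral_add_adjacent_intervals (hi 0 (3 ^ n)) (hi _ _), e1, e2,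
      ← intervalIntegral.integral_add (hi _ _) (Continuous.intervalIntegrable (by fun_prop) _ _),
      ← intervalIntegral.integral_add (Continuous.intervalIntegrable (by fun_prop) _ _)
        (Continuous.intervalIntegrable (by fun_prop) _ _)]
    have hle : ∫ s in (0:ℝ)..3 ^ n, (cc k (n + 1) s + cc k (n + 1) (s + 3 ^ n) + cc k (n + 1) (s + 2 * 3 ^ n))
        ≤ ∫ s in (0:ℝ)..3 ^ n, (1 + 2 * (√3 / 2) ^ k) * cc k n s := by
      apply intervalIntegral.integral_mono_on (by positivity)
        (Continuous.intervalIntegrable (by fun_prop) _ _)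
        (Continuous.intervalIntegrable (by fun_prop) _ _)
      intro s _
      have p1 : cc k n (s + 3 ^ n) = cc k n s := hper s
      have p2 : cc k n (s + 2 * 3 ^ n) = cc k n s := by
        rw [two_mul, ← add_assoc, hper, hper]
      rw [hs, hs, hs, p1, p2]
      have q1 : 2 * π * (s + 3 ^ n) / 3 ^ (n + 1) = 2 * π * s / 3 ^ (n + 1) + 2 * π / 3 := by
        rw [pow_succ]; field_simp
      have q2 : 2 * π * (s + 2 * 3 ^ n) / 3 ^ (n + 1) = 2 * π * s / 3 ^ (n + 1) + 2 * (2 * π / 3) := by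
        rw [pow_succ]; field_simp
      rw [q1, q2]
      have := mul_le_mul_of_nonneg_right (trig_sum k (2 * π * s / 3 ^ (n + 1))) (cc_nonneg k n s)
      linarith
    refine hle.trans ?_
    rw [intervalIntegral.integral_const_mul, pow_succ, mul_comm]
    exact mul_le_mul_of_nonneg_right ih (by positivity)

lemma cc_int2 (k n : ℕ) : ∫ s in (-(3:ℝ) ^ n)..3 ^ n, cc k n s ≤ 2 * (1 + 2 * (√3 / 2) ^ k) ^ n := by
  have hi : ∀ u v, IntervalIntegrable (cc k n) volume u v :=
      fun u v => (cc_cont k n).intervalIntegrable u v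
  rw [← intervalIntegral.integral_add_adjacent_intervals (hi _ 0) (hi _ _)]
  have := (cc_periodic k n).intervalIntegral_add_eq (-3 ^ n) 0
  rw [neg_add_cancel, zero_add] at this
  rw [this]
  linarith [cc_int k n]

noncomputable def LL (s : ℝ) : ℝ := ∏' j : ℕ, cos (2 * π * s / 3 ^ (j + 1))

lemma LL_mult (s : ℝ) : Multipliable (fun j : ℕ => cos (2 * π * s / 3 ^ (j + 1))) := by
  have h : Summable (fun j : ℕ => cos (2 * π * s / 3 ^ (j + 1)) - 1) := by
    have hg : Summable (fun j : ℕ => (2 * π * s) ^ 2 * (1 / 9 : ℝ) ^ j) :=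
      (summable_geometric_of_lt_one (by norm_num) (by norm_num)).mul_left _
    refine hg.of_norm_bounded fun j => ?_
    rw [Real.norm_eq_abs, abs_of_nonpos (by linarith [cos_le_one (2 * π * s / 3 ^ (j + 1))])]
    have h1 := one_sub_sq_div_two_le_cos (x := 2 * π * s / 3 ^ (j + 1))
    have h2 : (2 * π * s / 3 ^ (j + 1)) ^ 2 = (2 * π * s) ^ 2 * (1 / 9 : ℝ) ^ j / 9 := by
      rw [div_pow, ← pow_mul, show (1 / 9 : ℝ) = (1 / 3 ^ 2) by norm_num, div_pow, ← pow_mul, one_pow]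
      rw [show (j + 1) * 2 = 2 * j + 2 by ring, pow_add]
      field_simp
      norm_num
    rw [h2] at h1
    have : 0 ≤ (2 * π * s) ^ 2 * (1 / 9 : ℝ) ^ j := by positivity
    linarith
  have := Real.multipliable_one_add_of_summable h
  simpa using this

lemma LL_tendsto (s : ℝ) : Tendsto (fun n => ∏ j ∈ Finset.range n, cos (2 * π * s / 3 ^ (j + 1))) atTop
    (nhds (LL s)) := (LL_mult s).hasProd.tendsto_prod_nat

lemma LL_le (k n : ℕ) (s : ℝ) : |LL s| ^ k ≤ cc k n s := by
  have h : |LL s| ≤ ∏ j ∈ Finset.range n, |cos (2 * π * s / 3 ^ (j + 1))| := by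
    refine le_of_tendsto (LL_tendsto s).abs (eventually_atTop.2 ⟨n, fun N hN => ?_⟩)
    rw [Finset.abs_prod]
    rw [← Finset.prod_range_mul_prod_Ico _ hN]
    exact mul_le_of_le_one_right (Finset.prod_nonneg fun _ _ => abs_nonneg _)
      (Finset.prod_le_one (fun _ _ => abs_nonneg _) fun _ _ => abs_cos_le_one _)
  unfold cc
  rw [Finset.prod_pow]
  exact pow_le_pow_left₀ (abs_nonneg _) h k

lemma LL_int (k : ℕ) (δ : ℝ) (hδ : 0 < δ) (hk : 1 + 2 * (√3 / 2) ^ k < (3:ℝ) ^ δ)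
    (hc : Continuous fun s => |LL s| ^ k) :
    Integrable (fun s => |LL s| ^ k * (1 + |s|) ^ (-δ)) := by
  set A := 1 + 2 * (√3 / 2) ^ k with hA
  set g : ℝ → ℝ := fun s => |LL s| ^ k * (1 + |s|) ^ (-δ) with hg
  have hgc : Continuous g := by
    apply hc.mul
    apply Continuous.rpow_const (by fun_prop)
    intro x; left; positivity
  have hg0 : ∀ s, 0 ≤ g s := fun s => by simp only [hg]; positivity
  have hT : (0:ℝ) < 3 ^ δ := by positivity
  have hA1 : 0 < A := by positivity
  -- iterative bound
  have hstep : ∀ n : ℕ, ∫ s in (-(3:ℝ) ^ n)..3 ^ n, g s ≤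
      2 + ∑ i ∈ Finset.range n, 2 * A * (A / 3 ^ δ) ^ i := by
    intro n
    induction n with
    | zero =>
      have : ∫ s in (-(3:ℝ) ^ 0)..3 ^ 0, g s ≤ ∫ s in (-(3:ℝ) ^ 0)..3 ^ 0, cc k 0 s := by
        apply intervalIntegral.integral_mono_on (by norm_num) (hgc.intervalIntegrable _ _)
          ((cc_cont k 0).intervalIntegrable _ _)
        intro s _
        refine le_trans ?_ (LL_le k 0 s)
        exact mul_le_of_le_one_right (by positivity)
          (rpow_le_one_of_one_le_of_nonpos (by linarith [abs_nonneg s]) (by linarith))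
      refine this.trans ((cc_int2 k 0).trans ?_)
      simp
    | succ n ih =>
      have hpp : (0:ℝ) < 3 ^ n := by positivity
      have hlt : (3:ℝ) ^ n ≤ 3 ^ (n + 1) := by rw [pow_succ]; linarith
      have hgi : ∀ u v, IntervalIntegrable g volume u v := fun u v => hgc.intervalIntegrable u v
      have hci : ∀ u v, IntervalIntegrable (fun s => (((3:ℝ) ^ n) ^ (-δ)) * cc k (n + 1) s) volume u v :=
        fun u v => (continuous_const.mul (cc_cont k (n + 1))).intervalIntegrable u v
      have hb : ∀ s, (3:ℝ) ^ n ≤ |s| → g s ≤ (((3:ℝ) ^ n) ^ (-δ)) * cc k (n + 1) s := by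
        intro s hs
        simp only [hg]
        rw [mul_comm]
        apply mul_le_mul _ (LL_le k (n + 1) s) (by positivity) (by positivity)
        exact rpow_le_rpow_of_nonpos hpp (by linarith) (by linarith)
      have hb0 : ∀ s, 0 ≤ (((3:ℝ) ^ n) ^ (-δ)) * cc k (n + 1) s := fun s =>
        mul_nonneg (by positivity) (cc_nonneg _ _ _)
      have i1 : ∫ s in (-(3:ℝ) ^ (n + 1))..(-3 ^ n), g s ≤
          ∫ s in (-(3:ℝ) ^ (n + 1))..(-3 ^ n), (((3:ℝ) ^ n) ^ (-δ)) * cc k (n + 1) s := by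
        apply intervalIntegral.integral_mono_on (by linarith) (hgi _ _) (hci _ _)
        intro s hs
        exact hb s (by rw [abs_of_neg (by linarith [hs.2])]; linarith [hs.2])
      have i2 : ∫ s in ((3:ℝ) ^ n)..(3 ^ (n + 1)), g s ≤
          ∫ s in ((3:ℝ) ^ n)..(3 ^ (n + 1)), (((3:ℝ) ^ n) ^ (-δ)) * cc k (n + 1) s := by
        apply intervalIntegral.integral_mono_on (by linarith) (hgi _ _) (hci _ _)
        intro s hs
        exact hb s (by rw [abs_of_pos (by linarith [hs.1])]; linarith [hs.1])
      have i3 : 0 ≤ ∫ s in (-(3:ℝ) ^ n)..(3 ^ n), (((3:ℝ) ^ n) ^ (-δ)) * cc k (n + 1) s :=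
        intervalIntegral.integral_nonneg (by linarith) fun s _ => hb0 s
      have j1 := intervalIntegral.integral_add_adjacent_intervals (hgi (-(3:ℝ) ^ (n + 1)) (-3 ^ n)) (hgi _ (3 ^ n))
      have j2 := intervalIntegral.integral_add_adjacent_intervals (hgi (-(3:ℝ) ^ (n + 1)) (3 ^ n)) (hgi _ (3 ^ (n + 1)))
      have j3 := intervalIntegral.integral_add_adjacent_intervals (hci (-(3:ℝ) ^ (n + 1)) (-3 ^ n)) (hci _ (3 ^ n))
      have j4 := intervalIntegral.integral_add_adjacent_intervals (hci (-(3:ℝ) ^ (n + 1)) (3 ^ n)) (hci _ (3 ^ (n + 1)))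
      rw [intervalIntegral.integral_const_mul _ (cc k (n + 1)) (a := -(3:ℝ) ^ (n + 1)) (b := 3 ^ (n + 1))] at j4
      have j5 := mul_le_mul_of_nonneg_left (cc_int2 k (n + 1)) (show 0 ≤ ((3:ℝ) ^ n) ^ (-δ) by positivity)
      have j6 : ((3:ℝ) ^ n) ^ (-δ) * (2 * (1 + 2 * (√3 / 2) ^ k) ^ (n + 1)) = 2 * A * (A / 3 ^ δ) ^ n := by
        rw [← hA, rpow_neg hpp.le, ← rpow_natCast 3 n, ← rpow_mul (by norm_num), mul_comm (n:ℝ) δ,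
          rpow_mul (by norm_num), rpow_natCast, div_pow, pow_succ]
        field_simp
      rw [Finset.sum_range_succ]
      linarith
  have hr0 : 0 ≤ A / 3 ^ δ := by positivity
  have hr1 : A / 3 ^ δ < 1 := by rw [div_lt_one hT]; exact hk
  have hsum : Summable (fun i : ℕ => 2 * A * (A / 3 ^ δ) ^ i) :=
    (summable_geometric_of_lt_one hr0 hr1).mul_left _
  have ht : Tendsto (fun n : ℕ => (3:ℝ) ^ n) atTop atTop := tendsto_pow_atTop_atTop_of_one_lt (by norm_num)
  refine integrable_of_intervalIntegral_norm_bounded (2 + ∑' i : ℕ, 2 * A * (A / 3 ^ δ) ^ i)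
    (a := fun n : ℕ => -(3:ℝ) ^ n) (b := fun n : ℕ => (3:ℝ) ^ n) (l := atTop)
    (fun n => (hgc.integrableOn_Icc).mono_set Ioc_subset_Icc_self)
    (tendsto_neg_atTop_atBot.comp ht) ht (Eventually.of_forall fun n => ?_)
  have : ∀ s, ‖g s‖ = g s := fun s => Real.norm_of_nonneg (hg0 s)
  simp_rw [this]
  refine (hstep n).trans ?_
  gcongr
  exact hsum.sum_le_tsum _ (fun i _ => by positivity)

lemma numeric (k : ℕ) (ε : ℝ) (hε0 : 0 < ε) (hε : ε < 1 / 2)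
    (hk : Real.log (2 / ((3 : ℝ) ^ ε - 1)) / 0.027 ≤ (k : ℝ)) :
    1 + 2 * (√3 / 2) ^ k < (3:ℝ) ^ (ε / 2) := by
  have h3 : (√3) ^ 2 = 3 := Real.sq_sqrt (by norm_num)
  have hs0 : 0 ≤ √3 := Real.sqrt_nonneg 3
  have hs1 : √3 < 1.74 := by nlinarith
  have he1 : 1 < (3:ℝ) ^ ε := one_lt_rpow (by norm_num) hε0
  have he2 : (3:ℝ) ^ ε < 1.74 := by
    have : (3:ℝ) ^ ε < 3 ^ (1 / 2 : ℝ) := rpow_lt_rpow_of_exponent_lt (by norm_num) hε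
    rw [← sqrt_eq_rpow] at this
    linarith
  set y := Real.exp (-(0.027 * k)) with hy
  have hy0 : 0 < y := exp_pos _
  have h1 : 1 + 2 * y ≤ 3 ^ ε := by
    rw [div_le_iff₀ (by norm_num), Real.log_le_iff_le_exp (by apply div_pos <;> linarith),
      div_le_iff₀ (by linarith)] at hk
    have : y * Real.exp (k * 0.027) = 1 := by
      rw [hy, ← Real.exp_add]; simp; ring
    nlinarith
  have hy1 : y < 0.37 := by linarith
  have hq : (√3 / 2) ^ k ≤ y ^ 4 := by
    have : √3 / 2 ≤ Real.exp (-0.108) := by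
      have := Real.add_one_le_exp (-0.108)
      linarith
    calc (√3 / 2) ^ k ≤ Real.exp (-0.108) ^ k := pow_le_pow_left₀ (by positivity) this k
      _ = y ^ 4 := by
        rw [hy, ← Real.exp_nat_mul, ← Real.exp_nat_mul]; congr 1; push_cast; ring
  have hq0 : 0 ≤ (√3 / 2) ^ k := by positivity
  have hy2 : y ^ 2 < 0.14 := by nlinarith
  have hy3 : y ^ 4 < 0.06 * y := by nlinarith [mul_pos hy0 hy0]
  have hsq : (3:ℝ) ^ ε = ((3:ℝ) ^ (ε / 2)) ^ 2 := by
    rw [← rpow_natCast, ← rpow_mul (by norm_num)]; congr 1; push_cast; ring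
  apply lt_of_pow_lt_pow_left₀ 2 (by positivity)
  rw [← hsq]
  refine lt_of_lt_of_le ?_ h1
  nlinarith

open FourierTransform ContDiff in
lemma inv_facts (φ : ℝ → ℂ) (hc : HasCompactSupport φ) (hs : ContDiff ℝ ∞ φ) :
    Integrable (𝓕 φ) ∧ ∀ x : ℝ, ∫ ξ : ℝ, Complex.exp (Complex.I * ((2 * π * ξ : ℝ) : ℂ) * (x : ℂ)) * 𝓕 φ ξ = φ x := by
  have h1 : Integrable (𝓕 φ) := by
    have := (𝓕 (hc.toSchwartzMap hs)).integrable (μ := volume)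
    rw [SchwartzMap.fourier_coe] at this
    exact this
  refine ⟨h1, fun x => ?_⟩
  have hi : Integrable φ := hs.continuous.integrable_of_hasCompactSupport hc
  have h2 := hs.continuous.fourierInv_fourier_eq hi h1
  have h3 := congrFun h2 x
  rw [Real.fourierInv_eq'] at h3
  rw [← h3]
  congr 1
  ext ξ
  rw [smul_eq_mul]
  congr 2
  simp only [RCLike.inner_apply, conj_trivial]
  push_cast
  ring

open FourierTransform ContDiff in
lemma lemA (k : ℕ) (μ : Measure ℝ) [IsProbabilityMeasure μ]
    (hμ : ∀ t : ℝ, (∫ x, Complex.exp (Complex.I * (t : ℂ) * (x : ℂ)) ∂μ) = ((LL t : ℝ) : ℂ) ^ k)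
    (φ : ℝ → ℂ) (hc : HasCompactSupport φ) (hs : ContDiff ℝ ∞ φ) :
    ∫ x, φ x ∂μ = ∫ ξ : ℝ, ((LL (2 * π * ξ) : ℝ) : ℂ) ^ k * 𝓕 φ ξ := by
  obtain ⟨h1, h2⟩ := inv_facts φ hc hs
  simp_rw [← h2]
  rw [integral_integral_swap]
  · congr 1
    ext ξ
    rw [integral_mul_const, hμ]
  · have hb : Integrable (fun z : ℝ × ℝ => (1:ℂ) * 𝓕 φ z.2) (μ.prod volume) :=
      (integrable_const (1:ℂ)).mul_prod h1
    refine hb.mono ?_ (Eventually.of_forall fun z => ?_)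
    · apply AEStronglyMeasurable.mul
      · apply Continuous.aestronglyMeasurable
        fun_prop
      · simpa using hb.aestronglyMeasurable
    · simp only [Function.uncurry, norm_mul, one_mul]
      have : ‖Complex.exp (Complex.I * ((2 * π * z.2 : ℝ) : ℂ) * (z.1 : ℂ))‖ = 1 := by
        rw [mul_assoc, ← Complex.ofReal_mul, mul_comm]
        exact Complex.norm_exp_ofReal_mul_I _
      rw [this, one_mul]

open FourierTransform ContDiff in
lemma lemB0 (φ : ℝ → ℂ) (hc : HasCompactSupport φ) (hs : ContDiff ℝ ∞ φ) {ι : Type*}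
    (a : ι → ℝ) (ha : ∀ i, 0 ≤ a i) (s : Finset ι) :
    ∀ y : ℝ, (∀ x, |x - y| ≤ ∑ i ∈ s, a i → φ x = 1) →
    ∫ ξ : ℝ, ((∏ i ∈ s, cos (2 * π * ξ * a i) : ℝ) : ℂ) *
      (Complex.exp (Complex.I * ((2 * π * ξ : ℝ) : ℂ) * (y : ℂ)) * 𝓕 φ ξ) = 1 := by
  classical
  obtain ⟨h1, h2⟩ := inv_facts φ hc hs
  have hint : ∀ (s : Finset ι) (y : ℝ), Integrable (fun ξ : ℝ => ((∏ i ∈ s, cos (2 * π * ξ * a i) : ℝ) : ℂ) *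
      (Complex.exp (Complex.I * ((2 * π * ξ : ℝ) : ℂ) * (y : ℂ)) * 𝓕 φ ξ)) := by
    intro s y
    refine h1.mono ?_ (Eventually.of_forall fun ξ => ?_)
    · apply AEStronglyMeasurable.mul
      · apply Continuous.aestronglyMeasurable
        fun_prop
      · apply AEStronglyMeasurable.mul _ h1.aestronglyMeasurable
        apply Continuous.aestronglyMeasurable
        fun_prop
    · have : ‖Complex.exp (Complex.I * ((2 * π * ξ : ℝ) : ℂ) * (y : ℂ))‖ = 1 := by
        rw [mul_assoc, ← Complex.ofReal_mul, mul_comm]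
        exact Complex.norm_exp_ofReal_mul_I _
      rw [norm_mul, norm_mul, this, one_mul, Complex.norm_real, Real.norm_eq_abs, Finset.abs_prod]
      exact mul_le_of_le_one_left (norm_nonneg _)
        (Finset.prod_le_one (fun _ _ => abs_nonneg _) fun _ _ => abs_cos_le_one _)
  induction s using Finset.induction_on with
  | empty =>
    intro y hy
    simp only [Finset.prod_empty, Complex.ofReal_one, one_mul]
    rw [h2]
    exact hy y (by simp)
  | insert i s hi ih =>
    intro y hy
    rw [Finset.sum_insert hi] at hy
    have e1 := ih (y + a i) (fun x hx => hy x (by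
      have := abs_le.1 hx
      have := ha i
      rw [abs_le]; constructor <;> linarith))
    have e2 := ih (y - a i) (fun x hx => hy x (by
      have := abs_le.1 hx
      have := ha i
      rw [abs_le]; constructor <;> linarith))
    have : ∀ ξ : ℝ, ((∏ i ∈ insert i s, cos (2 * π * ξ * a i) : ℝ) : ℂ) *
      (Complex.exp (Complex.I * ((2 * π * ξ : ℝ) : ℂ) * (y : ℂ)) * 𝓕 φ ξ) =
       (1 / 2 : ℂ) * (((∏ i ∈ s, cos (2 * π * ξ * a i) : ℝ) : ℂ) *
      (Complex.exp (Complex.I * ((2 * π * ξ : ℝ) : ℂ) * ((y + a i : ℝ) : ℂ)) * 𝓕 φ ξ) +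
       ((∏ i ∈ s, cos (2 * π * ξ * a i) : ℝ) : ℂ) *
      (Complex.exp (Complex.I * ((2 * π * ξ : ℝ) : ℂ) * ((y - a i : ℝ) : ℂ)) * 𝓕 φ ξ)) := by
      intro ξ
      rw [Finset.prod_insert hi, Complex.ofReal_mul, Complex.ofReal_cos, Complex.cos]
      have q1 : Complex.exp (Complex.I * ((2 * π * ξ : ℝ) : ℂ) * ((y + a i : ℝ) : ℂ)) =
        Complex.exp (((2 * π * ξ * a i : ℝ) : ℂ) * Complex.I) *
          Complex.exp (Complex.I * ((2 * π * ξ : ℝ) : ℂ) * (y : ℂ)) := by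
        rw [← Complex.exp_add]; congr 1; push_cast; ring
      have q2 : Complex.exp (Complex.I * ((2 * π * ξ : ℝ) : ℂ) * ((y - a i : ℝ) : ℂ)) =
        Complex.exp (-((2 * π * ξ * a i : ℝ) : ℂ) * Complex.I) *
          Complex.exp (Complex.I * ((2 * π * ξ : ℝ) : ℂ) * (y : ℂ)) := by
        rw [← Complex.exp_add]; congr 1; push_cast; ring
      rw [q1, q2]
      ring
    simp_rw [this]
    rw [integral_const_mul, integral_add (hint s _) (hint s _), e1, e2]
    norm_num

lemma geom_bd (n : ℕ) : ∑ j ∈ Finset.range n, 2 * π / 3 ^ (j + 1) ≤ π := by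
  have : ∑ j ∈ Finset.range n, 2 * π / 3 ^ (j + 1) = π * (1 - 1 / 3 ^ n) := by
    induction n with
    | zero => simp
    | succ n ih => rw [Finset.sum_range_succ, ih, pow_succ]; field_simp; ring
  rw [this]
  have h : (0:ℝ) ≤ 1 / 3 ^ n := by positivity
  nlinarith [pi_pos]

open FourierTransform ContDiff in
lemma lemB (k : ℕ) (μ : Measure ℝ) [IsProbabilityMeasure μ]
    (hμ : ∀ t : ℝ, (∫ x, Complex.exp (Complex.I * (t : ℂ) * (x : ℂ)) ∂μ) = ((LL t : ℝ) : ℂ) ^ k)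
    (φ : ℝ → ℂ) (hc : HasCompactSupport φ) (hs : ContDiff ℝ ∞ φ) (h1 : ∀ x, |x| ≤ k * π → φ x = 1) :
    ∫ x, φ x ∂μ = 1 := by
  rw [lemA k μ hμ φ hc hs]
  obtain ⟨hi, h2⟩ := inv_facts φ hc hs
  have key : ∀ n : ℕ, ∫ ξ : ℝ, ((∏ j ∈ Finset.range n, cos (2 * π * (2 * π * ξ) / 3 ^ (j + 1)) : ℝ) : ℂ) ^ k * 𝓕 φ ξ = 1 := by
    intro n
    have := lemB0 φ hc hs (ι := ℕ × ℕ) (fun i => 2 * π / 3 ^ (i.2 + 1)) (fun i => by positivity)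
      (Finset.range k ×ˢ Finset.range n) 0 (fun x hx => h1 x (by
        rw [Finset.sum_product] at hx
        simp only [Finset.sum_const, Finset.card_range, nsmul_eq_mul, sub_zero] at hx
        exact hx.trans (mul_le_mul_of_nonneg_left (geom_bd n) (by positivity))))
    rw [← this]
    congr 1
    ext ξ
    rw [Finset.prod_product]
    simp only [Finset.prod_const, Finset.card_range, Complex.ofReal_zero, mul_zero, Complex.exp_zero, one_mul]
    rw [Complex.ofReal_pow]
    congr 5
    ext j
    congr 1
    ring
  have ht : Tendsto (fun n : ℕ => ∫ ξ : ℝ, ((∏ j ∈ Finset.range n, cos (2 * π * (2 * π * ξ) / 3 ^ (j + 1)) : ℝ) : ℂ) ^ k * 𝓕 φ ξ)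
      atTop (nhds (∫ ξ : ℝ, ((LL (2 * π * ξ) : ℝ) : ℂ) ^ k * 𝓕 φ ξ)) := by
    apply tendsto_integral_of_dominated_convergence (fun ξ => ‖𝓕 φ ξ‖)
    · intro n
      apply AEStronglyMeasurable.mul _ hi.aestronglyMeasurable
      apply Continuous.aestronglyMeasurable
      fun_prop
    · exact hi.norm
    · intro n
      refine Eventually.of_forall fun ξ => ?_
      rw [norm_mul, norm_pow, Complex.norm_real, Real.norm_eq_abs, Finset.abs_prod]
      exact mul_le_of_le_one_left (norm_nonneg _) (pow_le_one₀ (Finset.prod_nonneg fun _ _ => abs_nonneg _)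
        (Finset.prod_le_one (fun _ _ => abs_nonneg _) fun _ _ => abs_cos_le_one _))
    · refine Eventually.of_forall fun ξ => ?_
      apply Tendsto.mul_const
      apply Tendsto.pow
      exact (Complex.continuous_ofReal.tendsto _).comp (LL_tendsto (2 * π * ξ))
  simp_rw [key] at ht
  exact (tendsto_nhds_unique ht tendsto_const_nhds)

lemma ampl (χ : ℝ → ℝ) (R M B : ℝ) (hR : 0 < R) (hχ : ContDiff ℝ 1 χ) (hsupp : ∀ x, R ≤ |x| → χ x = 0)
    (hM : ∀ x, |deriv χ x| ≤ M) (q : Polynomial ℝ)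
    (hq : ∀ a b, a ≤ b → ‖∫ x in a..b, EE q x‖ ≤ B) :
    ‖∫ x, (χ x : ℂ) * EE q x‖ ≤ 2 * R * (M * B) := by
  have hM0 : 0 ≤ M := (abs_nonneg _).trans (hM 0)
  have e1 : ∫ x, (χ x : ℂ) * EE q x = ∫ x in (-R)..R, (χ x : ℂ) * EE q x := by
    symm
    apply intervalIntegral.integral_eq_integral_of_support_subset
    intro x hx
    by_contra hn
    apply hx
    have : R ≤ |x| := by
      by_contra hlt
      push Not at hlt
      exact hn ⟨(abs_lt.1 hlt).1, (abs_lt.1 hlt).2.le⟩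
    simp [hsupp x this]
  have hcont := EE_cont q
  have hd : ∀ x ∈ uIcc (-R) R, HasDerivAt (fun x => ∫ y in (-R)..x, EE q y) (EE q x) x := fun x _ =>
    intervalIntegral.integral_hasDerivAt_right (hcont.intervalIntegrable _ _)
      (hcont.stronglyMeasurableAtFilter _ _) hcont.continuousAt
  have hd2 : ∀ x ∈ uIcc (-R) R, HasDerivAt (fun x => (χ x : ℂ)) ((deriv χ x : ℝ) : ℂ) x := fun x _ =>
    ((hχ.differentiable (by norm_num)) x).hasDerivAt.ofReal_comp
  have hdc : Continuous (deriv χ) := hχ.continuous_deriv le_rfl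
  have hibp := intervalIntegral.integral_mul_deriv_eq_deriv_mul hd2 hd
    ((Complex.continuous_ofReal.comp hdc).intervalIntegrable _ _) (hcont.intervalIntegrable _ _)
  rw [e1, hibp, hsupp R (by rw [abs_of_pos hR]), hsupp (-R) (by rw [abs_neg, abs_of_pos hR])]
  simp only [Complex.ofReal_zero, zero_mul, sub_zero, zero_sub, norm_neg]
  have := intervalIntegral.norm_integral_le_of_norm_le_const (a := -R) (b := R) (C := M * B)
    (f := fun x => ((deriv χ x : ℝ) : ℂ) * ∫ y in (-R)..x, EE q y) (fun x hx => by
      rw [uIoc_of_le (by linarith)] at hx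
      rw [norm_mul, Complex.norm_real, Real.norm_eq_abs]
      exact mul_le_mul (hM x) (hq _ _ hx.1.le) (norm_nonneg _) hM0)
  refine this.trans (le_of_eq ?_)
  rw [abs_of_pos (by linarith)]; ring

noncomputable def PP (m : ℕ) (α : ℕ → ℝ) : Polynomial ℝ :=
  Polynomial.X ^ m + ∑ j ∈ Finset.range m, Polynomial.C (α j) * Polynomial.X ^ j

lemma PP_eval (m : ℕ) (α : ℕ → ℝ) (x : ℝ) :
    (PP m α).eval x = x ^ m + ∑ j ∈ Finset.range m, α j * x ^ j := by
  simp [PP, Polynomial.eval_finsetSum]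

lemma PP_deriv (m : ℕ) (hm : 2 ≤ m) (α : ℕ → ℝ) (t s x : ℝ) :
    (Polynomial.derivative^[m] (Polynomial.C t * PP m α - Polynomial.C s * Polynomial.X)).eval x
      = t * (m.factorial : ℝ) := by
  have h1 : Polynomial.derivative^[m] (Polynomial.X : Polynomial ℝ) = 0 :=
    Polynomial.iterate_derivative_eq_zero (by rw [Polynomial.natDegree_X]; omega)
  have h2 : Polynomial.derivative^[m] (∑ j ∈ Finset.range m, Polynomial.C (α j) * Polynomial.X ^ j) = 0 := by
    rw [Polynomial.iterate_derivative_sum]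
    refine Finset.sum_eq_zero fun j hj => Polynomial.iterate_derivative_eq_zero ?_
    exact lt_of_le_of_lt (Polynomial.natDegree_C_mul_X_pow_le _ _) (Finset.mem_range.1 hj)
  rw [Polynomial.iterate_derivative_sub, Polynomial.iterate_derivative_C_mul,
    Polynomial.iterate_derivative_C_mul, h1, PP, iterate_map_add, h2,
    Polynomial.iterate_derivative_X_pow_eq_C_mul]
  simp [Nat.descFactorial_self]

lemma vdcPP (m : ℕ) (hm : 2 ≤ m) (α : ℕ → ℝ) : ∃ C : ℝ, 0 < C ∧ ∀ t s : ℝ, 1 ≤ |t| → ∀ a b, a ≤ b →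
    ‖∫ x in a..b, EE (Polynomial.C t * PP m α - Polynomial.C s * Polynomial.X) x‖ ≤
      C * |t| ^ (-(1 / (m : ℝ))) := by
  obtain ⟨n, rfl⟩ := Nat.exists_eq_add_of_le' hm
  obtain ⟨C, hC, h⟩ := vdc n
  refine ⟨C, hC, fun t s ht a b hab => ?_⟩
  have hf : (1:ℝ) ≤ ((n + 2).factorial : ℝ) := by
    exact_mod_cast Nat.one_le_iff_ne_zero.2 (Nat.factorial_ne_zero _)
  have e : ((n + 2 : ℕ) : ℝ) = (n : ℝ) + 2 := by push_cast; ring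
  rw [e]
  rcases le_total 0 t with h0 | h0
  · refine h _ a b |t| hab (by linarith) fun x _ => ?_
    rw [PP_deriv _ hm, abs_of_nonneg h0]
    exact le_mul_of_one_le_right h0 hf
  · rw [← EE_neg]
    refine h _ a b |t| hab (by linarith) fun x _ => ?_
    rw [Polynomial.iterate_derivative_neg, Polynomial.eval_neg, PP_deriv _ hm, abs_of_nonpos h0, ← neg_mul]
    exact le_mul_of_one_le_right (by linarith) hf

lemma contLL (k : ℕ) (μ : Measure ℝ) [IsProbabilityMeasure μ]
    (hμ : ∀ t : ℝ, (∫ x, Complex.exp (Complex.I * (t : ℂ) * (x : ℂ)) ∂μ) = ((LL t : ℝ) : ℂ) ^ k) :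
    Continuous (fun t => |LL t| ^ k) := by
  have h1 : ∀ t, |LL t| ^ k = ‖∫ x, Complex.exp (Complex.I * (t : ℂ) * (x : ℂ)) ∂μ‖ := by
    intro t
    rw [hμ, norm_pow, Complex.norm_real, Real.norm_eq_abs]
  simp_rw [h1]
  apply Continuous.norm
  apply continuous_of_dominated (bound := fun _ => (1:ℝ))
  · intro t
    apply Continuous.aestronglyMeasurable
    fun_prop
  · intro t
    refine Eventually.of_forall fun x => le_of_eq ?_
    rw [mul_assoc, ← Complex.ofReal_mul, mul_comm]
    exact Complex.norm_exp_ofReal_mul_I _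
  · exact integrable_const _
  · refine Eventually.of_forall fun x => ?_
    fun_prop

lemma EE_smooth (p : Polynomial ℝ) : ContDiff ℝ (⊤ : ℕ∞) (EE p) := by
  unfold EE
  apply ContDiff.cexp
  apply contDiff_const.mul
  exact Complex.ofRealCLM.contDiff.comp (show ContDiff ℝ (⊤ : ℕ∞) (fun x => p.eval x) by
    have h := Polynomial.contDiff_aeval (𝕜 := ℝ) p (⊤ : ℕ∞)
    simp only [Polynomial.coe_aeval_eq_eval] at h
    exact h)

lemma interp (N C1 C2 T w δ ε : ℝ) (m : ℕ) (hm : 2 ≤ m) (hN : 0 ≤ N) (h1 : 0 < C1) (h2 : 0 < C2) (hT : 1 ≤ T)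
    (hw : 1 ≤ w) (hδ : δ = ε / 2) (hε0 : 0 < ε) (hε1 : ε < 1)
    (b1 : N ≤ C1 * T ^ (-(1 / (m : ℝ)))) (b2 : w * N ≤ C2 * T) :
    N ≤ C1 ^ (1 - δ) * C2 ^ δ * T ^ (ε - 1 / m) * w ^ (-δ) := by
  have hT0 : 0 < T := by linarith
  have hw0 : 0 < w := by linarith
  have b2' : N ≤ C2 * T * w⁻¹ := by
    rw [← div_eq_mul_inv, le_div_iff₀ hw0]; linarith
  have hmi : 1 / (m : ℝ) ≤ 1 := by
    rw [div_le_one (by positivity)]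
    exact_mod_cast (by omega : 1 ≤ m)
  have hmi0 : 0 ≤ 1 / (m : ℝ) := by positivity
  calc N = N ^ (1 - δ) * N ^ δ := by
        rw [← rpow_add_of_nonneg hN (by linarith) (by linarith)]; simp
    _ ≤ (C1 * T ^ (-(1 / (m : ℝ)))) ^ (1 - δ) * (C2 * T * w⁻¹) ^ δ := by
        apply mul_le_mul (rpow_le_rpow hN b1 (by linarith)) (rpow_le_rpow hN b2' (by linarith)) <;> positivity
    _ = C1 ^ (1 - δ) * C2 ^ δ * T ^ (-(1 / (m : ℝ)) * (1 - δ) + δ) * w ^ (-δ) := by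
        rw [mul_rpow h1.le (by positivity), mul_rpow (by positivity) (by positivity),
          mul_rpow h2.le hT0.le, ← rpow_mul hT0.le, rpow_add hT0, inv_rpow hw0.le, rpow_neg hw0.le]
        ring
    _ ≤ _ := by
        gcongr
        subst hδ
        nlinarith

open FourierTransform ContDiff in
lemma decay (χ : ℝ → ℝ) (hχ : ContDiff ℝ ∞ χ) (hc : HasCompactSupport χ) (P : Polynomial ℝ) :
    ∃ C : ℝ, 0 < C ∧ ∀ t ξ : ℝ, 1 ≤ |t| →
      (1 + |2 * π * ξ|) * ‖𝓕 (fun x => (χ x : ℂ) * EE (Polynomial.C t * P) x) ξ‖ ≤ C * |t| := by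
  have hdc : Continuous (deriv χ) := hχ.continuous_deriv (by simp)
  have hdcs : HasCompactSupport (deriv χ) := hc.deriv
  set G : ℝ → ℝ := fun x => |deriv χ x| + |χ x * P.derivative.eval x| with hG
  have hχc := hχ.continuous
  have hGi : Integrable G := by
    apply Integrable.add
    · exact (hdc.integrable_of_hasCompactSupport hdcs).abs
    · apply Integrable.abs
      apply Continuous.integrable_of_hasCompactSupport
      · exact hχc.mul P.derivative.continuous
      · exact hc.mul_right
  have hχi : Integrable χ := hχc.integrable_of_hasCompactSupport hc
  have n1 : 0 ≤ ∫ x, |χ x| := integral_nonneg fun x => abs_nonneg _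
  have n2 : 0 ≤ ∫ x, G x := integral_nonneg fun x => by simp only [hG]; positivity
  refine ⟨(∫ x, |χ x|) + (∫ x, G x) + 1, by linarith, fun t ξ ht => ?_⟩
  set φ : ℝ → ℂ := fun x => (χ x : ℂ) * EE (Polynomial.C t * P) x with hφ
  have hφs : ContDiff ℝ ∞ φ := (Complex.ofRealCLM.contDiff.comp hχ).mul (EE_smooth _)
  have hφc : HasCompactSupport φ := by
    apply HasCompactSupport.mul_right
    exact hc.comp_left (g := fun x : ℝ => (x : ℂ)) (by simp)
  have hφi : Integrable φ := hφs.continuous.integrable_of_hasCompactSupport hφc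
  have hφ'i : Integrable (deriv φ) :=
    (hφs.continuous_deriv (by simp)).integrable_of_hasCompactSupport hφc.deriv
  have hnf : ∀ f : ℝ → ℂ, ‖𝓕 f ξ‖ ≤ ∫ x, ‖f x‖ := fun f =>
    VectorFourier.norm_fourierIntegral_le_integral_norm _ _ _ _ _
  have f1 : ‖𝓕 φ ξ‖ ≤ ∫ x, |χ x| := by
    refine (hnf φ).trans (le_of_eq ?_)
    congr 1
    ext x
    simp only [hφ, norm_mul, EE_norm, mul_one, Complex.norm_real, Real.norm_eq_abs]
  have f2 : |2 * π * ξ| * ‖𝓕 φ ξ‖ ≤ |t| * ∫ x, G x := by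
    have := congrFun (Real.fourier_deriv hφi (hφs.differentiable (by simp)) hφ'i) ξ
    have h3 : |2 * π * ξ| * ‖𝓕 φ ξ‖ = ‖𝓕 (deriv φ) ξ‖ := by
      rw [this, norm_smul]
      congr 1
      simp
    rw [h3]
    refine (hnf _).trans ?_
    rw [← integral_const_mul]
    apply integral_mono hφ'i.norm (hGi.const_mul _)
    intro x
    have hd := (((hχ.differentiable (by simp)) x).hasDerivAt.ofReal_comp).mul (EE_hasDeriv (Polynomial.C t * P) x)
    have hd' : deriv φ x = _ := hd.deriv
    simp only []
    rw [hd']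
    refine (norm_add_le _ _).trans ?_
    simp only [Polynomial.derivative_mul, Polynomial.derivative_C, zero_mul, zero_add,
      Polynomial.eval_mul, Polynomial.eval_C, norm_mul, EE_norm, Complex.norm_real, Complex.norm_I,
      one_mul, mul_one, Real.norm_eq_abs, hG, abs_mul]
    have := abs_nonneg (deriv χ x)
    nlinarith
  nlinarith [abs_nonneg t]

open FourierTransform ContDiff in
/-- main -/
theorem stmt_9 (m : ℕ) (hm : 2 ≤ m) (α : ℕ → ℝ) (ε : ℝ) (hε0 : 0 < ε) (hεm : ε < 1 / m)
    (k : ℕ) (hk : Real.log (2 / ((3 : ℝ) ^ ε - 1)) / 0.027 ≤ (k : ℝ))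
    (μ : Measure ℝ) [IsProbabilityMeasure μ]
    (hμ : ∀ t : ℝ, (∫ x, Complex.exp (Complex.I * (t : ℂ) * (x : ℂ)) ∂μ) =
      ((∏' j : ℕ, Real.cos (2 * Real.pi * t / 3 ^ (j + 1)) : ℝ) : ℂ) ^ k) :
    (fun t : ℝ => ∫ x, Complex.exp (Complex.I * (t : ℂ) *
        ((x ^ m + ∑ j ∈ Finset.range m, α j * x ^ j : ℝ) : ℂ)) ∂μ)
      =O[Filter.cocompact ℝ] (fun t : ℝ => |t| ^ (ε - 1 / m)) := by
  replace hμ : ∀ t : ℝ, (∫ x, Complex.exp (Complex.I * (t : ℂ) * (x : ℂ)) ∂μ) = ((LL t : ℝ) : ℂ) ^ k := hμ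
  have hm2 : 1 / (m : ℝ) ≤ 1 / 2 := by
    apply one_div_le_one_div_of_le (by norm_num)
    exact_mod_cast hm
  have hnum := numeric k ε hε0 (by linarith) hk
  have hint := LL_int k (ε / 2) (by linarith) hnum (contLL k μ hμ)
  have hint2 := hint.comp_mul_left' (R := 2 * π) (by positivity)
  -- cutoff
  have hkπ : 0 ≤ k * π := by positivity
  let χ : ContDiffBump (0 : ℝ) := ⟨k * π + 1, k * π + 2, by linarith, by linarith⟩
  have hχs : ContDiff ℝ ∞ (χ : ℝ → ℝ) := χ.contDiff
  have hχc : HasCompactSupport (χ : ℝ → ℝ) := χ.hasCompactSupport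
  have hχ1 : ∀ x : ℝ, |x| ≤ k * π → χ x = 1 := fun x hx =>
    χ.one_of_mem_closedBall (by
      rw [mem_closedBall_zero_iff, Real.norm_eq_abs]
      change |x| ≤ k * π + 1
      linarith)
  have hχ0 : ∀ x : ℝ, k * π + 2 ≤ |x| → χ x = 0 := fun x hx =>
    χ.zero_of_le_dist (by rw [dist_zero_right, Real.norm_eq_abs]; exact hx)
  have hχsc : ContDiff ℝ ∞ (fun x => ((χ x : ℝ) : ℂ)) := Complex.ofRealCLM.contDiff.comp hχs
  have hχcc : HasCompactSupport (fun x => ((χ x : ℝ) : ℂ)) :=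
    hχc.comp_left (g := fun x : ℝ => (x : ℂ)) (by simp)
  have hae : ∀ᵐ x ∂μ, χ x = 1 := by
    have h1 := lemB k μ hμ _ hχcc hχsc (fun x hx => by rw [hχ1 x hx]; simp)
    rw [integral_complex_ofReal] at h1
    have h1' : ∫ x, χ x ∂μ = 1 := by exact_mod_cast h1
    have hi : Integrable (fun x => χ x) μ := hχs.continuous.integrable_of_hasCompactSupport hχc
    have h2 : ∫ x, (1 - χ x) ∂μ = 0 := by
      rw [integral_sub (integrable_const _) hi, h1']; simp
    replace h2 := (integral_eq_zero_iff_of_nonneg (f := fun x => 1 - χ x)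
      (fun x => by simpa using χ.le_one) ((integrable_const (1:ℝ)).sub hi)).1 h2
    filter_upwards [h2] with x hx
    simp only [Pi.zero_apply] at hx
    linarith
  obtain ⟨M, hM⟩ : ∃ M, ∀ x, |deriv (χ : ℝ → ℝ) x| ≤ M := by
    obtain ⟨M, hM⟩ := hχc.deriv.exists_bound_of_continuous (hχs.continuous_deriv (by simp))
    exact ⟨M, hM⟩
  have hM0 : 0 ≤ M := (abs_nonneg _).trans (hM 0)
  obtain ⟨C, hC, hv⟩ := vdcPP m hm α
  obtain ⟨C2, hC2, hdec⟩ := decay χ hχs hχc (PP m α)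
  set C1 := 2 * (k * π + 2) * (M * C) + 1 with hC1
  have hC1p : 0 < C1 := by positivity
  refine IsBigO.of_bound (C1 ^ (1 - ε / 2) * C2 ^ (ε / 2) *
    ∫ ξ : ℝ, |LL (2 * π * ξ)| ^ k * (1 + |2 * π * ξ|) ^ (-(ε / 2))) ?_
  have hev : ∀ᶠ t : ℝ in cocompact ℝ, 1 ≤ ‖t‖ := (tendsto_norm_cocompact_atTop (E := ℝ)).eventually_ge_atTop 1
  filter_upwards [hev] with t ht
  rw [Real.norm_eq_abs] at ht
  set φ : ℝ → ℂ := fun x => ((χ x : ℝ) : ℂ) * EE (Polynomial.C t * PP m α) x with hφ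
  have hφs : ContDiff ℝ ∞ φ := hχsc.mul (EE_smooth _)
  have hφc : HasCompactSupport φ := hχcc.mul_right
  have e1 : ∫ x, Complex.exp (Complex.I * (t : ℂ) *
        ((x ^ m + ∑ j ∈ Finset.range m, α j * x ^ j : ℝ) : ℂ)) ∂μ = ∫ x, φ x ∂μ := by
    apply integral_congr_ae
    filter_upwards [hae] with x hx
    simp only [hφ, hx, Complex.ofReal_one, one_mul, EE, Polynomial.eval_mul, Polynomial.eval_C, PP_eval]
    rw [Complex.ofReal_mul, mul_assoc]
  rw [e1, lemA k μ hμ φ hφc hφs]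
  have hb : ∀ ξ : ℝ, ‖𝓕 φ ξ‖ ≤ C1 ^ (1 - ε / 2) * C2 ^ (ε / 2) * |t| ^ (ε - 1 / m) *
      (1 + |2 * π * ξ|) ^ (-(ε / 2)) := by
    intro ξ
    refine interp _ C1 C2 |t| _ (ε / 2) ε m hm (norm_nonneg _) hC1p hC2 ht
      (by linarith [abs_nonneg (2 * π * ξ)]) rfl hε0 (by linarith) ?_ (hdec t ξ ht)
    have h1 := ampl χ (k * π + 2) M (C * |t| ^ (-(1 / (m : ℝ)))) (by positivity)
      (hχs.of_le (by simp)) hχ0 hM _ (hv t (2 * π * ξ) ht)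
    have h2 : 𝓕 φ ξ = ∫ x, ((χ x : ℝ) : ℂ) *
        EE (Polynomial.C t * PP m α - Polynomial.C (2 * π * ξ) * Polynomial.X) x := by
      rw [Real.fourier_real_eq_integral_exp_smul]
      congr 1
      ext x
      simp only [hφ, smul_eq_mul, EE, Polynomial.eval_sub, Polynomial.eval_mul, Polynomial.eval_C,
        Polynomial.eval_X]
      rw [mul_left_comm, ← Complex.exp_add]
      congr 2
      push_cast
      ring
    rw [h2]
    refine h1.trans ?_
    have : 0 < |t| ^ (-(1 / (m : ℝ))) := rpow_pos_of_pos (by linarith) _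
    rw [hC1]
    nlinarith
  have hfin : ‖∫ ξ : ℝ, ((LL (2 * π * ξ) : ℝ) : ℂ) ^ k * 𝓕 φ ξ‖ ≤
      ∫ ξ : ℝ, (C1 ^ (1 - ε / 2) * C2 ^ (ε / 2) * |t| ^ (ε - 1 / m)) *
        (|LL (2 * π * ξ)| ^ k * (1 + |2 * π * ξ|) ^ (-(ε / 2))) := by
    apply norm_integral_le_of_norm_le (hint2.const_mul _)
    refine Eventually.of_forall fun ξ => ?_
    rw [norm_mul, norm_pow, Complex.norm_real, Real.norm_eq_abs]
    have := mul_le_mul_of_nonneg_left (hb ξ) (show 0 ≤ |LL (2 * π * ξ)| ^ k by positivity)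
    linarith
  refine hfin.trans (le_of_eq ?_)
  rw [integral_const_mul, Real.norm_of_nonneg (by positivity)]
  ring
end

section
/- Let n ≥ 2, let A = (a_{ij})_{i,j=1}^n be a nonzero symmetric real matrix with a_{ii} = 0 for all i = 1,...,n, and let Q(x_1,...,x_n) = Σ_{i,j=1}^n a_{ij} x_i x_j. Let F be a symmetric probability distribution on ℝ belonging to the class 𝓕 (F has finite moments of all orders and is uniquely determined by its moments), and let Z_1,...,Z_n be i.i.d. with distribution F. Then for any i.i.d. symmetric random variables X_1,...,X_n, the equality in distribution Q(Z_1,...,Z_n) =_d Q(X_1,...,X_n) implies Z_1 =_d X_1 (i.e., the pair (Q,F) has the characterization property). -/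
open MeasureTheory Real Set

def AM {α : Type*} [MeasurableSpace α] (f : α → ℝ) (μ : Measure α) : Prop :=
  ∀ p : ℕ, MemLp f (p : ENNReal) μ

section
variable {α : Type*} [MeasurableSpace α] {μ : Measure α} {f g : α → ℝ}

lemma AM.add (hf : AM f μ) (hg : AM g μ) : AM (fun x => f x + g x) μ :=
  fun p => (hf p).add (hg p)

lemma AM.mul (hf : AM f μ) (hg : AM g μ) : AM (fun x => f x * g x) μ := by
  intro p
  have : ENNReal.HolderTriple ((2 * p : ℕ) : ENNReal) ((2 * p : ℕ) : ENNReal) (p : ENNReal) := by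
    constructor
    push_cast
    rw [ENNReal.mul_inv (by simp) (by simp), ← add_mul, ENNReal.inv_two_add_inv_two, one_mul]
  exact (hg (2 * p)).mul (hf (2 * p))

lemma AM.const [IsFiniteMeasure μ] (c : ℝ) : AM (fun _ => c) μ := fun _ => memLp_const c

lemma AM.pow [IsFiniteMeasure μ] (hf : AM f μ) (n : ℕ) : AM (fun x => f x ^ n) μ := by
  induction n with
  | zero => simpa using AM.const (μ := μ) 1
  | succ n ih => simpa [pow_succ] using ih.mul hf

lemma AM.sum {ι : Type*} (s : Finset ι) {f : ι → α → ℝ} (hf : ∀ i, AM (f i) μ) :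
    AM (fun x => ∑ i ∈ s, f i x) μ := fun p => memLp_finsetSum s fun i _ => hf i p

lemma AM.integrable (hf : AM f μ) : Integrable f μ :=
  memLp_one_iff_integrable.1 (by simpa using hf 1)

lemma AM.of_integrable (hm : Measurable f) (h : ∀ p : ℕ, Integrable (fun x => f x ^ p) μ) :
    AM f μ := by
  intro p
  rcases Nat.eq_zero_or_pos p with rfl | hp
  · simpa using hm.aestronglyMeasurable
  rw [← integrable_norm_rpow_iff hm.aestronglyMeasurable (by simpa using hp.ne') (by simp)]
  simpa using (h p).norm
end

section
variable {ι : Type*} [Fintype ι] [DecidableEq ι]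

lemma AM.coord (μ : ι → Measure ℝ) [∀ i, IsProbabilityMeasure (μ i)]
    (h : ∀ i, AM (fun x => x) (μ i)) (i : ι) : AM (fun y : ι → ℝ => y i) (Measure.pi μ) :=
  fun p => (h i p).comp_measurePreserving (measurePreserving_eval μ i)

lemma mp_update (μ : ι → Measure ℝ) [∀ i, IsProbabilityMeasure (μ i)] (k : ι)
    (ν : Measure ℝ) [IsProbabilityMeasure ν] :
    MeasurePreserving (fun p : ℝ × (ι → ℝ) => Function.update p.2 k p.1)
      (ν.prod (Measure.pi μ)) (Measure.pi (Function.update μ k ν)) := by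
  have hp : ∀ i, IsProbabilityMeasure (Function.update μ k ν i) := by
    intro i
    by_cases h : i = k
    · subst h; simpa
    · simpa [h] using inferInstanceAs (IsProbabilityMeasure (μ i))
  have hm : Measurable (fun p : ℝ × (ι → ℝ) => Function.update p.2 k p.1) := by
    rw [measurable_pi_iff]
    intro i
    by_cases h : i = k
    · subst h; simpa using measurable_fst
    · simp only [Function.update_of_ne h]; fun_prop
  refine ⟨hm, (Measure.pi_eq ?_).symm⟩
  intro s hs
  rw [Measure.map_apply hm (MeasurableSet.univ_pi hs)]
  have : (fun p : ℝ × (ι → ℝ) => Function.update p.2 k p.1) ⁻¹' univ.pi s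
      = s k ×ˢ univ.pi (Function.update s k univ) := by
    ext ⟨x, y⟩
    simp only [mem_preimage, mem_pi, mem_univ, true_implies, mem_prod]
    constructor
    · intro h
      refine ⟨by simpa using h k, fun i => ?_⟩
      by_cases hi : i = k
      · subst hi; simp
      · simpa [hi] using h i
    · rintro ⟨h1, h2⟩ i
      by_cases hi : i = k
      · subst hi; simpa using h1
      · simpa [hi] using h2 i
  rw [this, Measure.prod_prod, Measure.pi_pi,
    ← Finset.mul_prod_erase Finset.univ (fun i => (μ i) _) (Finset.mem_univ k),
    ← Finset.mul_prod_erase Finset.univ (fun i => (Function.update μ k ν i) _) (Finset.mem_univ k)]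
  simp only [Function.update_self, measure_univ, one_mul]
  congr 1
  refine Finset.prod_congr rfl fun i hi => ?_
  rw [Function.update_of_ne (Finset.ne_of_mem_erase hi),
    Function.update_of_ne (Finset.ne_of_mem_erase hi)]

lemma lin_zero (μ : ι → Measure ℝ) [∀ i, IsProbabilityMeasure (μ i)]
    (hs : ∀ i, Measure.map (fun x : ℝ => -x) (μ i) = μ i) (c : ι → ℝ)
    (h : ∀ᵐ y ∂(Measure.pi μ), ∑ i, c i * y i = 0) (j : ι) (hj : c j ≠ 0) :
    ∀ᵐ x ∂(μ j), x = 0 := by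
  have hf : MeasurePreserving (fun (y : ι → ℝ) i => (if i = j then (fun x : ℝ => -x) else id) (y i))
      (Measure.pi μ) (Measure.pi μ) := by
    refine measurePreserving_pi μ μ (f := fun i => if i = j then (fun x : ℝ => -x) else id) ?_
    intro i
    by_cases hi : i = j
    · simp only [hi, if_true]; exact ⟨measurable_neg, hs j⟩
    · simp only [hi, if_false]; exact MeasurePreserving.id _
  have h2 := hf.quasiMeasurePreserving.ae h
  have h3 : ∀ᵐ y ∂(Measure.pi μ), y j = 0 := by
    filter_upwards [h, h2] with y h1 h2
    have e := sub_eq_zero.2 (h1.trans h2.symm)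
    rw [← Finset.sum_sub_distrib, Finset.sum_eq_single j] at e
    · simp only [if_true] at e
      have : c j * y j = 0 := by linarith
      simpa [hj] using this
    · intro b _ hb; simp [hb]
    · simp
  rw [← (measurePreserving_eval μ j).map_eq]
  have hms : MeasurableSet {x : ℝ | x = 0} := measurableSet_singleton (0 : ℝ)
  exact (ae_map_iff (f := Function.eval j) (measurable_pi_apply j).aemeasurable hms).2 h3

def QQ (a : ι → ι → ℝ) (z : ι → ℝ) : ℝ := ∑ i, ∑ j, a i j * z i * z j

lemma QQ_update (a : ι → ι → ℝ) (hsymm : ∀ i j, a i j = a j i) (hdiag : ∀ i, a i i = 0)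
    (k : ι) (x : ℝ) (y : ι → ℝ) :
    QQ a (Function.update y k x) =
      x * (2 * ∑ j, a k j * y j) + QQ a (Function.update y k 0) := by
  have e : ∀ i, Function.update y k x i = Function.update y k 0 i + if i = k then x else 0 := by
    intro i
    by_cases h : i = k
    · subst h; simp
    · simp [h]
  have e2 : ∑ j, a k j * Function.update y k 0 j = ∑ j, a k j * y j := by
    refine Finset.sum_congr rfl fun j _ => ?_
    by_cases h : j = k
    · subst h; simp [hdiag]
    · simp [h]
  unfold QQ
  simp only [e, mul_add, add_mul, Finset.sum_add_distrib, mul_ite, ite_mul, mul_zero, zero_mul,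
    Finset.sum_ite_eq', Finset.mem_univ, if_true, Finset.sum_ite_irrel, Finset.sum_const_zero, hdiag, add_zero]
  rw [← e2, two_mul, mul_add, Finset.mul_sum]
  have e3 : ∀ j, a k j * x * Function.update y k 0 j = x * (a k j * Function.update y k 0 j) := by
    intro j; ring
  have e4 : ∀ j, a j k * Function.update y k 0 j * x = x * (a k j * Function.update y k 0 j) := by
    intro j; rw [hsymm j k]; ring
  simp only [e3, e4]
  ring

lemma step (a : ι → ι → ℝ) (hsymm : ∀ i j, a i j = a j i) (hdiag : ∀ i, a i i = 0)
    (μ : ι → Measure ℝ) [∀ i, IsProbabilityMeasure (μ i)] (hμ : ∀ i, AM (fun x => x) (μ i))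
    (k : ι) (ν : Measure ℝ) [IsProbabilityMeasure ν] (hν : AM (fun x => x) ν) (p : ℕ) :
    ∫ z, QQ a z ^ p ∂(Measure.pi (Function.update μ k ν)) =
      ∑ l ∈ Finset.range (p + 1), (∫ x, x ^ l ∂ν) *
        ∫ y, (2 * ∑ j, a k j * y j) ^ l * QQ a (Function.update y k 0) ^ (p - l) * p.choose l
          ∂(Measure.pi μ) := by
  have hc := AM.coord μ hμ
  have hQ : AM (fun y => QQ a (Function.update y k 0)) (Measure.pi μ) := by
    unfold QQ
    have hu : ∀ i, AM (fun y : ι → ℝ => Function.update y k 0 i) (Measure.pi μ) := by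
      intro i
      by_cases h : i = k
      · subst h; simpa using AM.const 0
      · simpa [h] using hc i
    exact AM.sum _ fun i => AM.sum _ fun j => ((AM.const _).mul (hu i)).mul (hu j)
  have hL : AM (fun y : ι → ℝ => 2 * ∑ j, a k j * y j) (Measure.pi μ) :=
    (AM.const _).mul (AM.sum _ fun i => (AM.const _).mul (hc i))
  have hmeas : Measurable (QQ a) := by unfold QQ; fun_prop
  rw [← (mp_update μ k ν).map_eq, integral_map (mp_update μ k ν).measurable.aemeasurable
    (hmeas.pow_const p).aestronglyMeasurable]
  have e0 : ∀ q : ℝ × (ι → ℝ), QQ a (Function.update q.2 k q.1) =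
      q.1 * (2 * ∑ j, a k j * q.2 j) + QQ a (Function.update q.2 k 0) :=
    fun q => QQ_update a hsymm hdiag k q.1 q.2
  rw [integral_congr_ae (Filter.Eventually.of_forall fun q => congrArg (· ^ p) (e0 q))]
  simp only [add_pow]
  have e : ∀ (q : ℝ × (ι → ℝ)) (l : ℕ), (q.1 * (2 * ∑ j, a k j * q.2 j)) ^ l *
      QQ a (Function.update q.2 k 0) ^ (p - l) * (p.choose l : ℝ) = q.1 ^ l *
      ((2 * ∑ j, a k j * q.2 j) ^ l *
      QQ a (Function.update q.2 k 0) ^ (p - l) * (p.choose l : ℝ)) := by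
    intro q l; rw [mul_pow]; ring
  simp only [e]
  rw [integral_finsetSum]
  · refine Finset.sum_congr rfl fun l _ => ?_
    exact integral_prod_mul (μ := ν) (ν := Measure.pi μ) (fun x : ℝ => x ^ l)
      (fun y : ι → ℝ => (2 * ∑ j, a k j * y j) ^ l *
        QQ a (Function.update y k 0) ^ (p - l) * (p.choose l : ℝ))
  · intro l _
    exact (hν.pow l).integrable.mul_prod
      (((hL.pow l).mul (hQ.pow (p - l))).mul (AM.const _)).integrable

lemma step_diff (a : ι → ι → ℝ) (hsymm : ∀ i j, a i j = a j i) (hdiag : ∀ i, a i i = 0)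
    (μ : ι → Measure ℝ) [∀ i, IsProbabilityMeasure (μ i)] (hμ : ∀ i, AM (fun x => x) (μ i))
    (k : ι) (F G : Measure ℝ) [IsProbabilityMeasure F] [IsProbabilityMeasure G]
    (hF : AM (fun x => x) F) (hG : AM (fun x => x) G) (p : ℕ)
    (hlow : ∀ l < p, ∫ x, x ^ l ∂F = ∫ x, x ^ l ∂G) :
    ∫ z, QQ a z ^ p ∂(Measure.pi (Function.update μ k G)) -
      ∫ z, QQ a z ^ p ∂(Measure.pi (Function.update μ k F)) =
      (∫ x, x ^ p ∂G - ∫ x, x ^ p ∂F) * ∫ y, (2 * ∑ j, a k j * y j) ^ p ∂(Measure.pi μ) := by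
  rw [step a hsymm hdiag μ hμ k G hG, step a hsymm hdiag μ hμ k F hF, Finset.sum_range_succ,
    Finset.sum_range_succ]
  rw [Finset.sum_congr rfl (fun l hl => by rw [hlow l (Finset.mem_range.1 hl)] :
    ∀ l ∈ Finset.range p, (∫ x, x ^ l ∂F) * _ = _)]
  simp
  ring

lemma mom_le (a : ι → ι → ℝ) (hsymm : ∀ i j, a i j = a j i) (hdiag : ∀ i, a i i = 0)
    (k j : ι) (hkj : a k j ≠ 0)
    (F G : Measure ℝ) [IsProbabilityMeasure F] [IsProbabilityMeasure G]
    (hF : AM (fun x => x) F) (hG : AM (fun x => x) G) 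
    (hGs : Measure.map (fun x : ℝ => -x) G = G) (p : ℕ) (hp : Even p) (hp0 : p ≠ 0)
    (hlow : ∀ l < p, ∫ x, x ^ l ∂F = ∫ x, x ^ l ∂G)
    (hQ : ∫ z, QQ a z ^ p ∂(Measure.pi fun _ => F) = ∫ z, QQ a z ^ p ∂(Measure.pi fun _ => G)) :
    ∫ x, x ^ p ∂G ≤ ∫ x, x ^ p ∂F := by
  by_contra! hlt
  let M : Finset ι → ι → Measure ℝ := fun s i => if i ∈ s then G else F
  have hMp : ∀ s i, IsProbabilityMeasure (M s i) := by
    intro s i; simp only [M]; split_ifs <;> infer_instance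
  have hMa : ∀ s i, AM (fun x => x) (M s i) := by
    intro s i; simp only [M]; split_ifs <;> assumption
  have mono : ∀ s, ∫ z, QQ a z ^ p ∂(Measure.pi (M ∅)) ≤ ∫ z, QQ a z ^ p ∂(Measure.pi (M s)) := by
    intro s
    induction s using Finset.induction_on with
    | empty => exact le_rfl
    | insert i s hi ih =>
      have h := step_diff a hsymm hdiag (M s) (hMa s) i F G hF hG p hlow
      have e1 : Function.update (M s) i G = M (insert i s) := by
        ext1 t
        by_cases ht : t = i
        · subst ht; simp [M]
        · simp [M, ht]
      have e2 : Function.update (M s) i F = M s := by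
        ext1 t
        by_cases ht : t = i
        · subst ht; simp [M, hi]
        · simp [M, ht]
      rw [e1, e2] at h
      have : 0 ≤ ∫ y, (2 * ∑ j, a i j * y j) ^ p ∂(Measure.pi (M s)) :=
        integral_nonneg fun y => hp.pow_nonneg _
      nlinarith
  have h := step_diff a hsymm hdiag (fun _ => G) (fun _ => hG) k F G hF hG p hlow
  have e1 : Function.update (fun _ => G) k G = fun _ : ι => G := by simp
  have e2 : Function.update (fun _ => G) k F = M (Finset.univ.erase k) := by
    ext1 t
    by_cases ht : t = k
    · subst ht; simp [M]
    · simp [M, ht]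
  have e3 : M ∅ = fun _ => F := by ext1 t; simp [M]
  have h1 := mono (Finset.univ.erase k)
  rw [e1, e2] at h
  rw [e3, hQ] at h1
  have hnn : 0 ≤ ∫ y, (2 * ∑ j, a k j * y j) ^ p ∂(Measure.pi fun _ : ι => G) :=
    integral_nonneg fun y => hp.pow_nonneg _
  have h0 : ∫ y, (2 * ∑ j, a k j * y j) ^ p ∂(Measure.pi fun _ : ι => G) = 0 := by
    nlinarith
  have hL : AM (fun y : ι → ℝ => 2 * ∑ j, a k j * y j) (Measure.pi fun _ : ι => G) :=
    (AM.const _).mul (AM.sum _ fun i => (AM.const _).mul (AM.coord _ (fun _ => hG) i))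
  rw [integral_eq_zero_iff_of_nonneg (fun y => hp.pow_nonneg _) (hL.pow p).integrable] at h0
  have hz := lin_zero (fun _ : ι => G) (fun _ => hGs) (a k)
    (by filter_upwards [h0] with y hy; simpa [hp0] using hy) j hkj
  have : ∫ x, x ^ p ∂G = 0 := by
    rw [integral_congr_ae (g := fun _ => (0:ℝ))]
    · simp
    · filter_upwards [hz] with x hx; simp [hx, hp0]
  have : 0 ≤ ∫ x, x ^ p ∂F := integral_nonneg fun y => hp.pow_nonneg _
  linarith

lemma odd_mom (F : Measure ℝ) (hs : Measure.map (fun x : ℝ => -x) F = F) (p : ℕ) (hp : Odd p) :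
    ∫ x, x ^ p ∂F = 0 := by
  have h : ∫ x, x ^ p ∂F = ∫ x, (-x) ^ p ∂F := by
    conv_lhs => rw [← hs]
    rw [integral_map measurable_neg.aemeasurable (by fun_prop)]
  simp only [hp.neg_pow, integral_neg] at h
  linarith

lemma AM_G (a : ι → ι → ℝ) (hsymm : ∀ i j, a i j = a j i) (hdiag : ∀ i, a i i = 0)
    (k j : ι) (hkj : a k j ≠ 0) (G : Measure ℝ) [IsProbabilityMeasure G]
    (hGs : Measure.map (fun x : ℝ => -x) G = G)
    (hQ : AM (QQ a) (Measure.pi fun _ => G)) : AM (fun x => x) G := by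
  by_cases hL : ∀ᵐ y ∂(Measure.pi fun _ : ι => G), ∑ i, a k i * y i = 0
  · have hz := lin_zero (fun _ : ι => G) (fun _ => hGs) (a k) hL j hkj
    intro p
    exact (memLp_congr_ae (g := fun _ => (0:ℝ)) hz).2 (memLp_const 0)
  · have hmp := mp_update (fun _ : ι => G) k G
    have e1 : Function.update (fun _ => G) k G = fun _ : ι => G := by simp
    rw [e1] at hmp
    have key : ∀ p : ℕ, ∀ᵐ y ∂(Measure.pi fun _ : ι => G),
        Integrable (fun x => QQ a (Function.update y k x) ^ p) G := by
      intro p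
      have h1 := hmp.integrable_comp_of_integrable (hQ.pow p).integrable
      exact h1.prod_left_ae
    rw [← ae_all_iff] at key
    obtain ⟨y, hy, hk⟩ := ((Filter.not_eventually.1 hL).and_eventually key).exists
    have hA : AM (fun x => QQ a (Function.update y k x)) G := by
      refine AM.of_integrable ?_ hk
      have e0 := funext fun x => QQ_update a hsymm hdiag k x y
      rw [e0]
      fun_prop
    have := (hA.add (AM.const (-QQ a (Function.update y k 0)))).mul
      (AM.const (2 * ∑ i, a k i * y i)⁻¹)
    convert this using 2 with x
    rw [QQ_update a hsymm hdiag k x y]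
    field_simp
    ring

lemma meas_QQ {ι : Type*} [Fintype ι] (a : ι → ι → ℝ) : Measurable (QQ a) := by unfold QQ; fun_prop

end

theorem stmt_14 (n : ℕ) (hn : 2 ≤ n) (a : Fin n → Fin n → ℝ)
    (hsymm : ∀ i j, a i j = a j i) (hA : a ≠ 0)
    (hdiag : ∀ i, a i i = 0)
    (F : Measure ℝ) [IsProbabilityMeasure F]
    (hFsymm : Measure.map (fun x : ℝ => -x) F = F)
    -- `F` has finite moments of all orders:
    (hmom : ∀ p : ℕ, Integrable (fun x : ℝ => x ^ p) F)
    -- `F` is uniquely determined by its moments: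
    (hdet : ∀ μ : Measure ℝ, IsProbabilityMeasure μ →
      (∀ p : ℕ, Integrable (fun x : ℝ => x ^ p) μ) →
      (∀ p : ℕ, (∫ x, x ^ p ∂μ) = ∫ x, x ^ p ∂F) → μ = F)
    (G : Measure ℝ) [IsProbabilityMeasure G]
    (hGsymm : Measure.map (fun x : ℝ => -x) G = G)
    (hQ : Measure.map (fun z : Fin n → ℝ => ∑ i, ∑ j, a i j * z i * z j)
        (Measure.pi fun _ => F) =
      Measure.map (fun z : Fin n → ℝ => ∑ i, ∑ j, a i j * z i * z j)
        (Measure.pi fun _ => G)) :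
    G = F := by
  change Measure.map (QQ a) _ = Measure.map (QQ a) _ at hQ
  have hm := meas_QQ a
  obtain ⟨k, hk⟩ := Function.ne_iff.1 hA
  obtain ⟨j, hkj⟩ := Function.ne_iff.1 hk
  have hF : AM (fun x => x) F := AM.of_integrable measurable_id hmom
  have hQF : AM (QQ a) (Measure.pi fun _ => F) := by
    have hc := AM.coord (fun _ : Fin n => F) (fun _ => hF)
    unfold QQ
    exact AM.sum _ fun i => AM.sum _ fun j => ((AM.const _).mul (hc i)).mul (hc j)
  have hQG : AM (QQ a) (Measure.pi fun _ => G) := by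
    intro p
    have h1 := (memLp_map_measure_iff (p := (p : ENNReal)) (g := (id : ℝ → ℝ))
      aestronglyMeasurable_id hm.aemeasurable).2 (hQF p)
    rw [hQ] at h1
    exact (memLp_map_measure_iff aestronglyMeasurable_id hm.aemeasurable).1 h1
  have hG := AM_G a hsymm hdiag k j hkj G hGsymm hQG
  have hQi : ∀ p : ℕ, ∫ z, QQ a z ^ p ∂(Measure.pi fun _ => F)
      = ∫ z, QQ a z ^ p ∂(Measure.pi fun _ => G) := by
    intro p
    rw [← integral_map (f := fun x : ℝ => x ^ p) hm.aemeasurable (by fun_prop), hQ,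
      integral_map hm.aemeasurable (by fun_prop)]
  refine hdet G inferInstance (fun p => (hG.pow p).integrable) fun p => ?_
  induction p using Nat.strong_induction_on with
  | _ p ih =>
    rcases Nat.even_or_odd p with hp | hp
    · rcases eq_or_ne p 0 with rfl | hp0
      · simp
      · exact le_antisymm
          (mom_le a hsymm hdiag k j hkj F G hF hG hGsymm p hp hp0 (fun l hl => (ih l hl).symm) (hQi p))
          (mom_le a hsymm hdiag k j hkj G F hG hF hFsymm p hp hp0 ih (hQi p).symm)
    · rw [odd_mom F hFsymm p hp, odd_mom G hGsymm p hp]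
end

section
/- Let n ≥ 2, let Q(x_1,...,x_n) = Σ_{i,j=1}^n a_{ij} x_i x_j be a quadratic form with nonzero symmetric matrix A, let F be a symmetric probability distribution on ℝ, and let Z_1,...,Z_n be i.i.d. with distribution F. Suppose the pair (Q,F) has the characterization property. For each N = 1, 2, ..., let X_{N,1},...,X_{N,n} be i.i.d. symmetric random variables, and suppose Q(X_{N,1},...,X_{N,n}) converges in distribution to Q(Z_1,...,Z_n) as N → ∞. Then X_{N,1} converges in distribution to Z_1 as N → ∞. -/
open MeasureTheory Real Set Filter
open scoped BoundedContinuousFunction Topology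

lemma mp_sign (G : Measure ℝ) [IsProbabilityMeasure G]
    (hG : Measure.map (fun x : ℝ => -x) G = G) (n : ℕ) (s : Fin n → ℝ)
    (hs : ∀ k, s k = 1 ∨ s k = -1) :
    MeasurePreserving (fun (z : Fin n → ℝ) k => s k * z k)
      (Measure.pi fun _ => G) (Measure.pi fun _ => G) := by
  refine measurePreserving_pi (fun _ => G) (fun _ => G) (f := fun k x => s k * x) fun k => ?_
  rcases hs k with h | h
  · simp only [h, one_mul]; exact MeasurePreserving.id G
  · simp only [h, neg_one_mul]; exact ⟨measurable_neg, hG⟩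

lemma mp_perm (G : Measure ℝ) [IsProbabilityMeasure G] (n : ℕ) (e : Fin n ≃ Fin n) :
    MeasurePreserving (fun (z : Fin n → ℝ) k => z (e k))
      (Measure.pi fun _ => G) (Measure.pi fun _ => G) := by
  have h := measurePreserving_piCongrLeft (α := fun _ : Fin n => ℝ) (fun _ => G) e.symm
  convert! h using 1
  funext z k
  have := MeasurableEquiv.piCongrLeft_apply_apply (β := fun _ : Fin n => ℝ) e.symm z (e k)
  rw [Equiv.symm_apply_apply] at this
  exact this.symm

lemma meas_Q (n : ℕ) (a : Fin n → Fin n → ℝ) :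
    Continuous (fun z : Fin n → ℝ => ∑ i, ∑ j, a i j * z i * z j) := by fun_prop

lemma flip_id (n : ℕ) (a : Fin n → Fin n → ℝ) (hsymm : ∀ i j, a i j = a j i) (i j : Fin n)
    (hij : i ≠ j) (z : Fin n → ℝ) (s t : Fin n → ℝ) (hs : s = fun k => if k = i then -1 else 1)
    (ht : t = fun k => if k = j then -1 else 1) :
    (∑ k, ∑ l, a k l * z k * z l)
      - (∑ k, ∑ l, a k l * (s k * z k) * (s l * z l))
      - (∑ k, ∑ l, a k l * (t k * z k) * (t l * z l))
      + (∑ k, ∑ l, a k l * (s k * t k * z k) * (s l * t l * z l)) = 8 * a i j * (z i * z j) := by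
  have key : ∀ k l, a k l * z k * z l - a k l * (s k * z k) * (s l * z l)
      - a k l * (t k * z k) * (t l * z l) + a k l * (s k * t k * z k) * (s l * t l * z l)
      = (if k = i then if l = j then 4 * a i j * (z i * z j) else 0 else 0)
        + (if k = j then if l = i then 4 * a i j * (z i * z j) else 0 else 0) := by
    intro k l
    have h0 := hsymm i j
    by_cases h1 : k = i <;> by_cases h2 : l = i <;> by_cases h3 : k = j <;> by_cases h4 : l = j <;>
      simp [hs, ht, h1, h2, h3, h4] <;> grind
  simp only [← Finset.sum_sub_distrib, ← Finset.sum_add_distrib, key]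
  simp only [Finset.sum_add_distrib]
  simp [Finset.sum_ite_eq]
  ring

lemma offdiag (n : ℕ) (a : Fin n → Fin n → ℝ) (hsymm : ∀ i j, a i j = a j i) (i j : Fin n)
    (hij : i ≠ j) (ha : a i j ≠ 0) (G : Measure ℝ) [IsProbabilityMeasure G]
    (hG : Measure.map (fun x : ℝ => -x) G = G) (K : ℝ) (hK : 0 ≤ K) :
    (G {x | √(K / (2 * |a i j|)) < |x|}) ^ 2 ≤
      4 * (Measure.pi fun _ : Fin n => G) {z | K < |∑ i, ∑ j, a i j * z i * z j|} := by
  classical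
  set M := √(K / (2 * |a i j|)) with hM
  set μ := (Measure.pi fun _ : Fin n => G)
  set S : Set ℝ := {x | M < |x|}
  set Q : (Fin n → ℝ) → ℝ := fun z => ∑ i, ∑ j, a i j * z i * z j with hQ
  have hQm : Measurable Q := (meas_Q n a).measurable
  set T : Set (Fin n → ℝ) := {z | K < |Q z|}
  have hT : MeasurableSet T := measurableSet_lt measurable_const (by fun_prop)
  have h1 : (G S) ^ 2 = μ (Set.pi univ fun k => if k ∈ ({i, j} : Finset (Fin n)) then S else univ) := by
    rw [Measure.pi_pi]
    simp only [apply_ite, measure_univ]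
    rw [Finset.prod_ite_mem, Finset.univ_inter, Finset.prod_const, Finset.card_pair hij]
  set s : Fin n → ℝ := fun k => if k = i then -1 else 1 with hs
  set t : Fin n → ℝ := fun k => if k = j then -1 else 1 with ht
  have hs1 : ∀ k, s k = 1 ∨ s k = -1 := fun k => by simp only [hs]; split_ifs <;> simp
  have ht1 : ∀ k, t k = 1 ∨ t k = -1 := fun k => by simp only [ht]; split_ifs <;> simp
  have hst1 : ∀ k, s k * t k = 1 ∨ s k * t k = -1 := fun k => by
    rcases hs1 k with h | h <;> rcases ht1 k with h' | h' <;> simp [h, h']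
  have m1 := mp_sign G hG n s hs1
  have m2 := mp_sign G hG n t ht1
  have m3 := mp_sign G hG n (fun k => s k * t k) hst1
  have hM2 : M ^ 2 = K / (2 * |a i j|) := Real.sq_sqrt (by positivity)
  have hM0 : 0 ≤ M := Real.sqrt_nonneg _
  have ha' : 0 < |a i j| := abs_pos.mpr ha
  have sub : (Set.pi univ fun k => if k ∈ ({i, j} : Finset (Fin n)) then S else univ) ⊆
      ((T ∪ (fun (z : Fin n → ℝ) k => s k * z k) ⁻¹' T) ∪ (fun (z : Fin n → ℝ) k => t k * z k) ⁻¹' T)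
        ∪ (fun (z : Fin n → ℝ) k => s k * t k * z k) ⁻¹' T := by
    intro z hz
    have hi : M < |z i| := by simpa [S] using hz i (mem_univ _)
    have hj : M < |z j| := by simpa [S] using hz j (mem_univ _)
    by_contra hcon
    simp only [mem_union, not_or, mem_preimage, T, mem_setOf_eq, not_lt] at hcon
    obtain ⟨⟨⟨c1, c2⟩, c3⟩, c4⟩ := hcon
    have e := flip_id n a hsymm i j hij z s t hs ht
    have e' : |8 * a i j * (z i * z j)| ≤ 4 * K := by
      rw [← e]
      rw [abs_le] at c1 c2 c3 c4 ⊢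
      simp only [hQ] at c1 c2 c3 c4
      constructor <;> linarith [c1.1, c2.1, c3.1, c4.1, c1.2, c2.2, c3.2, c4.2]
    have e2 : M ^ 2 < |z i| * |z j| := by nlinarith
    rw [hM2, div_lt_iff₀ (by positivity)] at e2
    rw [abs_mul, abs_mul, abs_mul] at e'
    norm_num at e'
    nlinarith
  rw [h1]
  calc _ ≤ _ := measure_mono sub
    _ ≤ μ T + μ T + μ T + μ T := by
      refine (measure_union_le _ _).trans (add_le_add ((measure_union_le _ _).trans
        (add_le_add ((measure_union_le _ _).trans (add_le_add le_rfl ?_)) ?_)) ?_)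
      · exact (m1.measure_preimage hT.nullMeasurableSet).le
      · exact (m2.measure_preimage hT.nullMeasurableSet).le
      · exact (m3.measure_preimage hT.nullMeasurableSet).le
    _ = 4 * μ T := by ring

lemma diag_eq (n : ℕ) (a : Fin n → Fin n → ℝ) (hd : ∀ i j, i ≠ j → a i j = 0) (z : Fin n → ℝ) :
    ∑ i, ∑ j, a i j * z i * z j = ∑ i, a i i * z i ^ 2 := by
  refine Finset.sum_congr rfl fun i _ => ?_
  rw [Finset.sum_eq_single i]
  · ring
  · intro j _ hj; rw [hd i j hj.symm]; ring
  · simp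

lemma diagcase (n : ℕ) [NeZero n] (a : Fin n → Fin n → ℝ) (hd : ∀ i j, i ≠ j → a i j = 0)
    (ht : ∑ i, a i i ≠ 0) (G : Measure ℝ) [IsProbabilityMeasure G] (K : ℝ) (hK : 0 ≤ K) :
    G {x | √(n * K / |∑ i, a i i|) < |x|} ≤
      n * (Measure.pi fun _ : Fin n => G) {z | K < |∑ i, ∑ j, a i j * z i * z j|} := by
  set t := ∑ i, a i i
  set M := √(n * K / |t|) with hM
  set μ := (Measure.pi fun _ : Fin n => G)
  set Q : (Fin n → ℝ) → ℝ := fun z => ∑ i, ∑ j, a i j * z i * z j with hQ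
  have hQm : Measurable Q := (meas_Q n a).measurable
  set T : Set (Fin n → ℝ) := {z | K < |Q z|}
  have hT : MeasurableSet T := measurableSet_lt measurable_const (by fun_prop)
  have hS : MeasurableSet {x : ℝ | M < |x|} := measurableSet_lt measurable_const (by fun_prop)
  have h1 : G {x | M < |x|} = μ ((fun z : Fin n → ℝ => z 0) ⁻¹' {x | M < |x|}) :=
    ((measurePreserving_eval (fun _ : Fin n => G) 0).measure_preimage hS.nullMeasurableSet).symm
  have hM2 : M ^ 2 = n * K / |t| := Real.sq_sqrt (by positivity)
  have hM0 : 0 ≤ M := Real.sqrt_nonneg _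
  have ht' : 0 < |t| := abs_pos.mpr ht
  have sub : ((fun z : Fin n → ℝ => z 0) ⁻¹' {x | M < |x|}) ⊆
      ⋃ k : Fin n, (fun (z : Fin n → ℝ) l => z (Equiv.addRight k l)) ⁻¹' T := by
    intro z hz
    by_contra hcon
    simp only [mem_iUnion, not_exists, mem_preimage, T, mem_setOf_eq, not_lt] at hcon hz
    have e : ∑ k, Q (fun l => z (Equiv.addRight k l)) = t * ∑ i, z i ^ 2 := by
      simp only [hQ, diag_eq n a hd]
      rw [Finset.sum_comm, Finset.sum_mul]
      refine Finset.sum_congr rfl fun i _ => ?_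
      rw [← Finset.mul_sum]
      congr 1
      exact Equiv.sum_comp (Equiv.addLeft i) (fun k => z k ^ 2)
    have e1 : |t * ∑ i, z i ^ 2| ≤ n * K := by
      rw [← e]
      refine (Finset.abs_sum_le_sum_abs _ _).trans ((Finset.sum_le_sum fun k _ => hcon k).trans ?_)
      simp
    have e2 : z 0 ^ 2 ≤ ∑ i, z i ^ 2 :=
      Finset.single_le_sum (f := fun i => z i ^ 2) (fun i _ => sq_nonneg _) (Finset.mem_univ 0)
    have e3 : M ^ 2 < z 0 ^ 2 := by rw [← sq_abs (z 0)]; nlinarith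
    rw [hM2, div_lt_iff₀ ht'] at e3
    rw [abs_mul, abs_of_nonneg (a := ∑ i, z i ^ 2) (Finset.sum_nonneg fun i _ => sq_nonneg _)] at e1
    nlinarith
  rw [h1]
  refine (measure_mono sub).trans ((measure_iUnion_fintype_le _ _).trans ?_)
  refine (Finset.sum_le_sum fun k _ =>
    ((mp_perm G n (Equiv.addRight k)).measure_preimage hT.nullMeasurableSet).le).trans ?_
  simp [T, Q, μ]

lemma shift_ne (ν : Measure ℝ) [IsProbabilityMeasure ν] (h0 : ν (Iio 0) = 0)
    (h : ν.map (fun x => x + 1) = ν) : False := by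
  have h1 : ∀ k : ℕ, ν (Iio (k : ℝ)) = 0 := by
    intro k
    induction k with
    | zero => simpa using h0
    | succ k ih =>
      rw [← h, Measure.map_apply (by fun_prop) measurableSet_Iio, ← ih]
      congr 1; ext x; simp
  have h2 : ν univ = 0 := by
    have : (univ : Set ℝ) = ⋃ k : ℕ, Iio (k : ℝ) := by
      ext x; simpa using exists_nat_gt x
    rw [this]; exact measure_iUnion_null h1
  simp at h2

lemma trace_ne (n : ℕ) (a : Fin n → Fin n → ℝ) (hd : ∀ i j, i ≠ j → a i j = 0)
    (ht : ∑ i, a i i = 0)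
    (F : Measure ℝ) [IsProbabilityMeasure F]
    (hCP : ∀ G : Measure ℝ, IsProbabilityMeasure G →
      Measure.map (fun x : ℝ => -x) G = G →
      Measure.map (fun z : Fin n → ℝ => ∑ i, ∑ j, a i j * z i * z j)
          (Measure.pi fun _ => G) =
        Measure.map (fun z : Fin n → ℝ => ∑ i, ∑ j, a i j * z i * z j)
          (Measure.pi fun _ => F) →
      G = F) : False := by
  have law : ∀ (H : Measure ℝ) [IsProbabilityMeasure H],
      Measure.map (fun z : Fin n → ℝ => ∑ i, ∑ j, a i j * z i * z j) (Measure.pi fun _ => H)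
      = Measure.map (fun y : Fin n → ℝ => ∑ i, a i i * y i)
        (Measure.pi fun _ => H.map (fun x => x ^ 2)) := by
    intro H _
    have : IsProbabilityMeasure (H.map (fun x : ℝ => x ^ 2)) :=
      Measure.isProbabilityMeasure_map (by fun_prop)
    rw [← Measure.pi_map_pi (fun _ => by fun_prop), Measure.map_map (by fun_prop) (by fun_prop)]
    congr 1
    ext z
    exact diag_eq n a hd z
  let g : ℝ → ℝ := fun x => √(x ^ 2 + 1)
  have hg : Measurable g := by fun_prop
  let G : Measure ℝ := (2⁻¹ : ENNReal) • (F.map g + F.map (fun x => - g x))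
  have p1 : IsProbabilityMeasure (F.map g) := Measure.isProbabilityMeasure_map (by fun_prop)
  have p2 : IsProbabilityMeasure (F.map (fun x => - g x)) :=
    Measure.isProbabilityMeasure_map (by fun_prop)
  have pG : IsProbabilityMeasure G := ⟨by
    simp only [G, Measure.smul_apply, Measure.add_apply, measure_univ, smul_eq_mul]
    rw [one_add_one_eq_two]; exact ENNReal.inv_mul_cancel (by simp) (by simp)⟩
  have sG : Measure.map (fun x : ℝ => -x) G = G := by
    simp only [G]
    rw [Measure.map_smul, Measure.map_add _ _ (by fun_prop), Measure.map_map (by fun_prop) hg,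
      Measure.map_map (by fun_prop) (by fun_prop), add_comm]
    congr 2
    congr 1; ext x; simp
  have sq : ∀ x, g x ^ 2 = x ^ 2 + 1 := fun x => Real.sq_sqrt (by positivity)
  have sqG : G.map (fun x => x ^ 2) = (F.map (fun x => x ^ 2)).map (fun x => x + 1) := by
    simp only [G]
    rw [Measure.map_smul, Measure.map_add _ _ (by fun_prop), Measure.map_map (by fun_prop) hg,
      Measure.map_map (by fun_prop) (by fun_prop), Measure.map_map (by fun_prop) (by fun_prop)]
    have e1 : ((fun x : ℝ => x ^ 2) ∘ g) = (fun x => x + 1) ∘ (fun x => x ^ 2) := by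
      ext x; simp [sq]
    have e2 : ((fun x : ℝ => x ^ 2) ∘ fun x => - g x) = (fun x => x + 1) ∘ (fun x => x ^ 2) := by
      ext x; simp [sq]
    rw [e1, e2, ← two_smul ENNReal, smul_smul, ENNReal.inv_mul_cancel (by simp) (by simp), one_smul]
  have pF2 : IsProbabilityMeasure (F.map (fun x : ℝ => x ^ 2)) :=
    Measure.isProbabilityMeasure_map (by fun_prop)
  have pF3 : IsProbabilityMeasure ((F.map (fun x : ℝ => x ^ 2)).map (fun x => x + 1)) :=
    Measure.isProbabilityMeasure_map (by fun_prop)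
  have hGF : G = F := by
    refine hCP G pG sG ?_
    rw [law G, law F, sqG, ← Measure.pi_map_pi (fun _ => by fun_prop),
      Measure.map_map (by fun_prop) (by fun_prop)]
    congr 1
    ext y
    simp [mul_add, Finset.sum_add_distrib, ht]
  rw [hGF] at sqG
  refine shift_ne (F.map (fun x : ℝ => x ^ 2)) ?_ sqG.symm
  rw [Measure.map_apply (by fun_prop) measurableSet_Iio]
  convert! measure_empty (μ := F)
  ext x; simp; positivity

/-- (Theorem 14: stability.) Let `n ≥ 2`, `Q(x) = Σ a_{ij} x_i x_j` with
nonzero symmetric matrix `A`, and let `F` be a symmetric probability distribution such that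
the pair `(Q, F)` has the characterization property. If `X_{N,1},…,X_{N,n}` are i.i.d.
symmetric random variables (common distribution `G_N`) such that `Q(X_{N,1},…,X_{N,n})`
converges in distribution to `Q(Z₁,…,Z_n)` (`Zᵢ` i.i.d. `F`) as `N → ∞`, then `X_{N,1}`
converges in distribution to `Z₁`.  Convergence in distribution is expressed as convergence
of integrals of all bounded continuous functions. -/
theorem stmt_17 (n : ℕ) (hn : 2 ≤ n) (a : Fin n → Fin n → ℝ)
    (hsymm : ∀ i j, a i j = a j i) (hA : a ≠ 0)
    (F : Measure ℝ) [IsProbabilityMeasure F]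
    (hFsymm : Measure.map (fun x : ℝ => -x) F = F)
    -- the pair `(Q, F)` has the characterization property:
    (hCP : ∀ G : Measure ℝ, IsProbabilityMeasure G →
      Measure.map (fun x : ℝ => -x) G = G →
      Measure.map (fun z : Fin n → ℝ => ∑ i, ∑ j, a i j * z i * z j)
          (Measure.pi fun _ => G) =
        Measure.map (fun z : Fin n → ℝ => ∑ i, ∑ j, a i j * z i * z j)
          (Measure.pi fun _ => F) →
      G = F)
    (G : ℕ → Measure ℝ) (hGprob : ∀ N, IsProbabilityMeasure (G N))
    (hGsymm : ∀ N, Measure.map (fun x : ℝ => -x) (G N) = G N)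
    -- `Q(X_{N,1},…,X_{N,n}) → Q(Z₁,…,Z_n)` in distribution:
    (hconv : ∀ f : ℝ →ᵇ ℝ,
      Tendsto (fun N => ∫ u, f u
          ∂(Measure.map (fun z : Fin n → ℝ => ∑ i, ∑ j, a i j * z i * z j)
            (Measure.pi fun _ => G N))) atTop
        (𝓝 (∫ u, f u
          ∂(Measure.map (fun z : Fin n → ℝ => ∑ i, ∑ j, a i j * z i * z j)
            (Measure.pi fun _ => F))))) :
    -- then `X_{N,1} → Z₁` in distribution:
    ∀ f : ℝ →ᵇ ℝ,
      Tendsto (fun N => ∫ x, f x ∂(G N)) atTop (𝓝 (∫ x, f x ∂F)) := by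
  classical
  haveI : NeZero n := ⟨by omega⟩
  haveI := hGprob
  have core : ∃ (m : ℕ) (R : ℝ → ℝ), ∀ (H : Measure ℝ), IsProbabilityMeasure H →
      Measure.map (fun x : ℝ => -x) H = H → ∀ K : ℝ, 0 ≤ K → (H {x | R K < |x|}) ^ 2 ≤
        m * (Measure.pi fun _ : Fin n => H) {z | K < |∑ i, ∑ j, a i j * z i * z j|} := by
    by_cases hd : ∀ i j, i ≠ j → a i j = 0
    · by_cases ht : ∑ i, a i i = 0
      · exact (trace_ne n a hd ht F hCP).elim
      · refine ⟨n, fun K => √(n * K / |∑ i, a i i|), fun H _ _ K hK => ?_⟩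
        refine le_trans ?_ (diagcase n a hd ht H K hK)
        exact pow_le_of_le_one zero_le prob_le_one two_ne_zero
    · push Not at hd
      obtain ⟨i, j, hij, ha⟩ := hd
      refine ⟨4, fun K => √(K / (2 * |a i j|)), fun H _ hH K hK => ?_⟩
      exact offdiag n a hsymm i j hij ha H hH K hK
  obtain ⟨m, R, core⟩ := core
  have hQc := meas_Q n a
  set Q : (Fin n → ℝ) → ℝ := fun z => ∑ i, ∑ j, a i j * z i * z j with hQ
  let P : ProbabilityMeasure ℝ → ProbabilityMeasure ℝ := fun μ =>
    (ProbabilityMeasure.pi fun _ : Fin n => μ).map hQc.measurable.aemeasurable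
  have hP : Continuous P := by
    have h1 : Continuous fun μ : ProbabilityMeasure ℝ => (ProbabilityMeasure.pi fun _ : Fin n => μ) :=
      ProbabilityMeasure.continuous_pi.comp (continuous_pi fun _ => continuous_id)
    exact (ProbabilityMeasure.continuous_map hQc).comp h1
  have hPc : ∀ μ : ProbabilityMeasure ℝ, (P μ : Measure ℝ) =
      Measure.map Q (Measure.pi fun _ => (μ : Measure ℝ)) := fun μ => rfl
  let g : ℕ → ProbabilityMeasure ℝ := fun N => ⟨G N, hGprob N⟩
  let F' : ProbabilityMeasure ℝ := ⟨F, inferInstance⟩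
  have hlim : Tendsto (fun N => P (g N)) atTop (𝓝 (P F')) :=
    ProbabilityMeasure.tendsto_iff_forall_integral_tendsto.mpr hconv
  have tightQ : IsTightMeasureSet
      {((μ : ProbabilityMeasure ℝ) : Measure ℝ) | μ ∈ Set.range fun N => P (g N)} := by
    apply isTightMeasureSet_of_isCompact_closure
    exact hlim.isCompact_insert_range.closure_of_subset (Set.subset_insert _ _)
  have tightG : IsTightMeasureSet {((μ : ProbabilityMeasure ℝ) : Measure ℝ) | μ ∈ Set.range g} := by
    have tq := tendsto_measure_norm_gt_of_isTightMeasureSet tightQ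
    rw [isTightMeasureSet_iff_exists_isCompact_measure_compl_le]
    intro ε hε
    have hδ : (0 : ENNReal) < (min ε 1) ^ 2 / (m + 1) :=
      ENNReal.div_pos (pow_ne_zero 2 (lt_min hε one_pos).ne') (by finiteness)
    obtain ⟨K, hK0, hK⟩ := ((eventually_ge_atTop (0 : ℝ)).and
      (tq.eventually (gt_mem_nhds hδ))).exists
    refine ⟨Metric.closedBall 0 (R K), isCompact_closedBall _ _, ?_⟩
    rintro _ ⟨_, ⟨N, rfl⟩, rfl⟩
    have e1 : (Metric.closedBall (0 : ℝ) (R K))ᶜ = {x | R K < |x|} := by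
      ext x; simp
    rw [e1]
    have e2 := core (G N) (hGprob N) (hGsymm N) K hK0
    have e3 : (Measure.pi fun _ : Fin n => G N) {z | K < |Q z|} ≤ (min ε 1) ^ 2 / (m + 1) := by
      refine le_trans ?_ hK.le
      refine le_trans ?_ (le_iSup₂ (f := fun (μ : Measure ℝ) (_ : μ ∈
        {((μ : ProbabilityMeasure ℝ) : Measure ℝ) | μ ∈ Set.range fun N => P (g N)}) =>
          μ {x | K < ‖x‖}) (P (g N) : Measure ℝ) ⟨_, ⟨N, rfl⟩, rfl⟩)
      rw [hPc, Measure.map_apply hQc.measurable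
        (measurableSet_lt measurable_const (by fun_prop))]
      exact le_of_eq rfl
    have e4 : (G N {x | R K < |x|}) ^ 2 ≤ (min ε 1) ^ 2 := by
      refine e2.trans ((mul_le_mul_right e3 _).trans ?_)
      refine (mul_le_mul_left (le_self_add : (m : ENNReal) ≤ m + 1) _).trans ?_
      exact (ENNReal.mul_div_cancel (by simp) (by finiteness)).le
    have e5 : G N {x | R K < |x|} ≤ min ε 1 := (ENNReal.pow_le_pow_left_iff two_ne_zero).mp e4
    exact e5.trans (min_le_left _ _)
  have comp := isCompact_closure_of_isTightMeasureSet tightG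
  have main : Tendsto g atTop (𝓝 F') := by
    refine tendsto_of_subseq_tendsto fun ns hns => ?_
    obtain ⟨L, -, φ, hφ, hL⟩ := comp.tendsto_subseq (x := fun k => g (ns k))
      fun k => subset_closure ⟨_, rfl⟩
    refine ⟨φ, ?_⟩
    have hsub : Tendsto (fun k => ns (φ k)) atTop atTop := hns.comp hφ.tendsto_atTop
    have q1 : P L = P F' :=
      tendsto_nhds_unique ((hP.tendsto L).comp hL) (hlim.comp hsub)
    have q2 : L.map (f := fun x : ℝ => -x) (by fun_prop) = L := by
      refine tendsto_nhds_unique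
        (ProbabilityMeasure.tendsto_map_of_tendsto_of_continuous _ _ hL continuous_neg) ?_
      convert! hL using 2 with k
      exact Subtype.ext (hGsymm _)
    have q3 : (L : Measure ℝ) = F :=
      hCP L inferInstance (congrArg Subtype.val q2) (congrArg Subtype.val q1)
    have q4 : L = F' := Subtype.ext q3
    rw [← q4]; exact hL
  exact ProbabilityMeasure.tendsto_iff_forall_integral_tendsto.mp main
end
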